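/- Let x ∈ K, s ∈ (0,∞), n ≥ 1 and k ∈ {2,…,l_n}. If s ∈ [(k−1)/L_n, k/L_n], then (1/18)·k²/T_n ≤ Ψ(s) ≤ (9/2)·k²/T_n and (7/36)·k/M_n ≤ m(B_d(x,s)) ≤ 6·k/M_n; whereas if s ∈ [1,3], then 1 ≤ Ψ(s) ≤ 14 and 7/12 ≤ m(B_d(x,s)) ≤ 1. Here B_d(x,s) is the open d-ball of radius s around x. -/

import Mathlib

open scoped BigOperators ENNReal
open Set Filter MeasureTheory

noncomputable section

abbrev E2 : Type := EuclideanSpace ℝ (Fin 2)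

/-- The index set `S_l` of the level-`l` thin Sierpinski gasket. -/
def Sset (l : ℕ) : Set (ℕ × ℕ) :=
  {p | p.1 + p.2 ≤ l - 1 ∧ p.1 * p.2 * (l - 1 - p.1 - p.2) = 0}

/-- The contraction `f^l_i`. -/
def fmap (q : Fin 3 → E2) (l : ℕ) (i : ℕ × ℕ) (x : E2) : E2 :=
  q 0 + ((i.1 : ℝ) / l) • (q 1 - q 0) + ((i.2 : ℝ) / l) • (q 2 - q 0)
    + (l : ℝ)⁻¹ • (x - q 0)

/-- The closed equilateral triangle `△`. -/
def Tri (q : Fin 3 → E2) : Set E2 := convexHull ℝ (Set.range q)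

def V0 (q : Fin 3 → E2) : Set E2 := Set.range q

/-- Words of length `n` (padded by `(0,0)` beyond position `n`). -/
def Wn (l : ℕ → ℕ) (n : ℕ) : Set (ℕ → ℕ × ℕ) :=
  {w | (∀ k, k < n → w k ∈ Sset (l k)) ∧ ∀ k, n ≤ k → w k = (0, 0)}

/-- `wordMap q l w n = f^{l_1}_{w_1} ∘ ⋯ ∘ f^{l_n}_{w_n}` (0-indexed). -/
def wordMap (q : Fin 3 → E2) (l : ℕ → ℕ) (w : ℕ → ℕ × ℕ) : ℕ → E2 → E2
  | 0 => id
  | n + 1 => wordMap q l w n ∘ fmap q (l n) (w n)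

/-- The thin scale irregular Sierpinski gasket `K`. -/
def Gasket (q : Fin 3 → E2) (l : ℕ → ℕ) : Set E2 :=
  ⋂ n, ⋃ w ∈ Wn l n, wordMap q l w n '' Tri q

/-- The cell `K_w = K ∩ f_w(△)`. -/
def Cell (q : Fin 3 → E2) (l : ℕ → ℕ) (n : ℕ) (w : ℕ → ℕ × ℕ) : Set E2 :=
  Gasket q l ∩ wordMap q l w n '' Tri q

def Vn (q : Fin 3 → E2) (l : ℕ → ℕ) (n : ℕ) : Set E2 :=
  ⋃ w ∈ Wn l n, wordMap q l w n '' V0 q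

def Vstar (q : Fin 3 → E2) (l : ℕ → ℕ) : Set E2 := ⋃ n, Vn q l n

def Ln (l : ℕ → ℕ) (n : ℕ) : ℕ := ∏ k ∈ Finset.range n, l k

def Mn (l : ℕ → ℕ) (n : ℕ) : ℕ := ∏ k ∈ Finset.range n, (3 * l k - 3)

def rl (l : ℕ) : ℝ := (2 * (l : ℝ) / 3 + 1 / 9)⁻¹

def Rn (l : ℕ → ℕ) (n : ℕ) : ℝ := ∏ k ∈ Finset.range n, rl (l k)

def Tn (l : ℕ → ℕ) (n : ℕ) : ℝ := (Mn l n : ℝ) / Rn l n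

/-- The basic energy form `E⁰` on `ℝ^{V₀}`. -/
def E0 (q : Fin 3 → E2) (u v : E2 → ℝ) : ℝ :=
  (1 / 2) * ∑ j : Fin 3, ∑ k : Fin 3, (u (q j) - u (q k)) * (v (q j) - v (q k))

/-- The level-`n` energy form `Eⁿ`. -/
def En (q : Fin 3 → E2) (l : ℕ → ℕ) (n : ℕ) (u v : E2 → ℝ) : ℝ :=
  (Rn l n)⁻¹ * ∑ᶠ w ∈ Wn l n, E0 q (u ∘ wordMap q l w n) (v ∘ wordMap q l w n)

/-- The domain `F` of the limit resistance form. -/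
def FDom (q : Fin 3 → E2) (l : ℕ → ℕ) : Set (E2 → ℝ) :=
  {u | ∃ C : ℝ, ∀ n, En q l n u u ≤ C}

/-- The limit form `E(u,v) = lim_n Eⁿ(u,v)`. -/
def EForm (q : Fin 3 → E2) (l : ℕ → ℕ) (u v : E2 → ℝ) : ℝ :=
  limUnder atTop fun n => En q l n u v

/-- The intrinsic (geodesic) distance on `K`, with values in `ℝ≥0∞`. -/
def pdist (q : Fin 3 → E2) (l : ℕ → ℕ) (x y : E2) : ℝ≥0∞ :=
  ⨅ (γ : ℝ → E2) (_ : ContinuousOn γ (Set.Icc 0 1))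
    (_ : Set.MapsTo γ (Set.Icc 0 1) (Gasket q l)) (_ : γ 0 = x) (_ : γ 1 = y),
    eVariationOn γ (Set.Icc 0 1)

def gdist (q : Fin 3 → E2) (l : ℕ → ℕ) (x y : E2) : ℝ := (pdist q l x y).toReal

/-- The set of resistance quotients used to define `R_E`. -/
def REset (q : Fin 3 → E2) (l : ℕ → ℕ) (x y : E2) : Set ℝ :=
  {t | ∃ u ∈ FDom q l, 0 < EForm q l u u ∧ t = (u x - u y) ^ 2 / EForm q l u u}

/-- The resistance metric `R_E`. -/
def RE (q : Fin 3 → E2) (l : ℕ → ℕ) (x y : E2) : ℝ := sSup (REset q l x y)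

/-- Resistance quotients over continuous representatives (i.e. `F` viewed in `C(K)`). -/
def REcSet (q : Fin 3 → E2) (l : ℕ → ℕ) (x y : E2) : Set ℝ :=
  {t | ∃ u ∈ FDom q l, ContinuousOn u (Gasket q l) ∧ 0 < EForm q l u u ∧
    t = (u x - u y) ^ 2 / EForm q l u u}

def REc (q : Fin 3 → E2) (l : ℕ → ℕ) (x y : E2) : ℝ := sSup (REcSet q l x y)

/-- The open `d`-ball in `K`. -/
def Bd (q : Fin 3 → E2) (l : ℕ → ℕ) (x : E2) (s : ℝ) : Set E2 :=
  {y ∈ Gasket q l | gdist q l x y < s}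

/-- The open `R_E`-ball in `K`. -/
def BRc (q : Fin 3 → E2) (l : ℕ → ℕ) (x : E2) (s : ℝ) : Set E2 :=
  {y ∈ Gasket q l | REc q l x y < s}

/-- `Λ^{(k)}_{n,w}`: words within `k` cell-steps of `w`. -/
def Lam (q : Fin 3 → E2) (l : ℕ → ℕ) (n : ℕ) (w : ℕ → ℕ × ℕ) (k : ℕ) :
    Set (ℕ → ℕ × ℕ) :=
  {v ∈ Wn l n | ∃ c : ℕ → ℕ → ℕ × ℕ, c 0 = w ∧ c k = v ∧ (∀ j ≤ k, c j ∈ Wn l n) ∧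
    ∀ j < k, (Cell q l n (c j) ∩ Cell q l n (c (j + 1))).Nonempty}

/-- `U^{(k)}_{n,w}`. -/
def Unwk (q : Fin 3 → E2) (l : ℕ → ℕ) (n : ℕ) (w : ℕ → ℕ × ℕ) (k : ℕ) : Set E2 :=
  ⋃ v ∈ Lam q l n w k, Cell q l n v

def betaZero (l : ℕ → ℕ) : ℝ :=
  ⨅ n : ℕ, Real.logb (l n) (2 * (l n : ℝ) ^ 2 - (5 / 3) * (l n : ℝ) - 1 / 3)

def betaOne (l : ℕ → ℕ) : ℝ :=
  ⨆ n : ℕ, Real.logb (l n) (2 * (l n : ℝ) ^ 2 - (5 / 3) * (l n : ℝ) - 1 / 3)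

def betaM (l : ℕ → ℕ) : ℝ := ⨅ n : ℕ, Real.logb (l n) (3 * (l n : ℝ) - 3)

def betaR (l : ℕ → ℕ) : ℝ := ⨆ n : ℕ, Real.logb (l n) ((rl (l n))⁻¹)

/-- The value of `Ψ` on the interval `[1/L_{n+1}, 1/L_n]`. -/
def psiPiece (l : ℕ → ℕ) (n : ℕ) (s : ℝ) : ℝ :=
  (Tn l (n + 1))⁻¹
    * (1 + ((3 * (l n : ℝ) - 4) / ((l n : ℝ) - 1)) * ((Ln l (n + 1) : ℝ) * s - 1))
    * (1 + (((2 / 3) * (l n : ℝ) - 8 / 9) / ((l n : ℝ) - 1)) * ((Ln l (n + 1) : ℝ) * s - 1))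

/-- `Ψ = Ψ_𝒍` is characterized by these defining clauses. -/
def IsPsi (l : ℕ → ℕ) (Psi : ℝ → ℝ) : Prop :=
  (∀ n : ℕ, ∀ s : ℝ, ((Ln l (n + 1) : ℝ))⁻¹ ≤ s → s ≤ ((Ln l n : ℝ))⁻¹ →
      Psi s = psiPiece l n s) ∧
  (∀ s : ℝ, 1 ≤ s → Psi s = s ^ betaZero l) ∧ Psi 0 = 0

def psiMPiece (l : ℕ → ℕ) (n : ℕ) (s : ℝ) : ℝ :=
  ((Mn l (n + 1) : ℝ))⁻¹
    * (1 + ((3 * (l n : ℝ) - 4) / ((l n : ℝ) - 1)) * ((Ln l (n + 1) : ℝ) * s - 1))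

def IsPsiM (l : ℕ → ℕ) (PsiM : ℝ → ℝ) : Prop :=
  (∀ n : ℕ, ∀ s : ℝ, ((Ln l (n + 1) : ℝ))⁻¹ ≤ s → s ≤ ((Ln l n : ℝ))⁻¹ →
      PsiM s = psiMPiece l n s) ∧
  (∀ s : ℝ, 1 ≤ s → PsiM s = s ^ betaM l) ∧ PsiM 0 = 0

def psiRPiece (l : ℕ → ℕ) (n : ℕ) (s : ℝ) : ℝ :=
  Rn l (n + 1)
    * (1 + (((2 / 3) * (l n : ℝ) - 8 / 9) / ((l n : ℝ) - 1)) * ((Ln l (n + 1) : ℝ) * s - 1))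

def IsPsiR (l : ℕ → ℕ) (PsiR : ℝ → ℝ) : Prop :=
  (∀ n : ℕ, ∀ s : ℝ, ((Ln l (n + 1) : ℝ))⁻¹ ≤ s → s ≤ ((Ln l n : ℝ))⁻¹ →
      PsiR s = psiRPiece l n s) ∧
  (∀ s : ℝ, 1 ≤ s → PsiR s = s ^ betaR l) ∧ PsiR 0 = 0

/-- `μ` is the uniform distribution on `K`: a Borel measure carried by `K`
with `μ(K_w) = 1/M_{|w|}` for every word `w`. -/
def IsUnif (q : Fin 3 → E2) (l : ℕ → ℕ) (μ : Measure E2) : Prop :=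
  μ (Gasket q l)ᶜ = 0 ∧ ∀ n : ℕ, ∀ w ∈ Wn l n, μ (Cell q l n w) = ((Mn l n : ℝ≥0∞))⁻¹

/-- `μ` is the energy measure of `u`: a Borel measure carried by `K` with
`μ(K_w) = R_{|w|}⁻¹ E^{𝒍^{|w|}}(u∘F_w, u∘F_w)` for every word `w`. -/
def IsEnergyMeasure (q : Fin 3 → E2) (l : ℕ → ℕ) (u : E2 → ℝ) (μ : Measure E2) : Prop :=
  μ (Gasket q l)ᶜ = 0 ∧ ∀ n : ℕ, ∀ w ∈ Wn l n,
    μ (Cell q l n w) = ENNReal.ofReal ((Rn l n)⁻¹ *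
      EForm q (fun k => l (k + n)) (u ∘ wordMap q l w n) (u ∘ wordMap q l w n))

section
def pt (q : Fin 3 → E2) (a b : ℝ) : E2 := q 0 + a • (q 1 - q 0) + b • (q 2 - q 0)

lemma pt_dist_sq (q : Fin 3 → E2) (hq : ∀ j k : Fin 3, j ≠ k → dist (q j) (q k) = 1)
    (a b a' b' : ℝ) : dist (pt q a b) (pt q a' b') ^ 2
      = (a - a') ^ 2 + (b - b') ^ 2 + (a - a') * (b - b') := by
  have h1 : ‖q 1 - q 0‖ = 1 := by rw [← dist_eq_norm]; exact hq 1 0 (by decide)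
  have h2 : ‖q 2 - q 0‖ = 1 := by rw [← dist_eq_norm]; exact hq 2 0 (by decide)
  have h3 : ‖(q 1 - q 0) - (q 2 - q 0)‖ = 1 := by
    rw [sub_sub_sub_cancel_right, ← dist_eq_norm]; exact hq 1 2 (by decide)
  have h4 := norm_sub_sq_real (q 1 - q 0) (q 2 - q 0)
  rw [h1, h2, h3] at h4
  have e : pt q a b - pt q a' b' = (a - a') • (q 1 - q 0) + (b - b') • (q 2 - q 0) := by
    unfold pt; module
  rw [dist_eq_norm, e, norm_add_sq_real, norm_smul, norm_smul, h1, h2, inner_smul_left,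
    inner_smul_right]
  simp only [mul_one, Real.norm_eq_abs, sq_abs, conj_trivial]
  have : inner ℝ (q 1 - q 0) (q 2 - q 0) = (1 / 2 : ℝ) := by linarith
  rw [this]; ring

lemma pt_inj (q : Fin 3 → E2) (hq : ∀ j k : Fin 3, j ≠ k → dist (q j) (q k) = 1)
    {a b a' b' : ℝ} (h : pt q a b = pt q a' b') : a = a' ∧ b = b' := by
  have := pt_dist_sq q hq a b a' b'
  rw [h, dist_self] at this
  constructor <;> nlinarith [sq_nonneg (a - a'), sq_nonneg (b - b'), sq_nonneg (a - a' + (b - b'))]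

lemma pt_dist_le (q : Fin 3 → E2) (hq : ∀ j k : Fin 3, j ≠ k → dist (q j) (q k) = 1)
    (a b a' b' : ℝ) : dist (pt q a b) (pt q a' b') ≤ |a - a'| + |b - b'| := by
  apply le_of_sq_le_sq _ (by positivity)
  rw [pt_dist_sq q hq]
  have := le_abs_self ((a - a') * (b - b'))
  rw [abs_mul] at this
  nlinarith [sq_abs (a - a'), sq_abs (b - b'), mul_nonneg (abs_nonneg (a-a')) (abs_nonneg (b-b'))]

/-- first / second lattice coordinates of the corners -/
def ex (j : Fin 3) : ℤ := if j = 1 then 1 else 0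
def ey (j : Fin 3) : ℤ := if j = 2 then 1 else 0

lemma q_eq_pt (q : Fin 3 → E2) (j : Fin 3) : q j = pt q (ex j) (ey j) := by
  fin_cases j <;> simp [pt, ex, ey]

def px (l : ℕ → ℕ) (w : ℕ → ℕ × ℕ) : ℕ → ℤ
  | 0 => 0
  | n + 1 => (l n : ℤ) * px l w n + (w n).1

def py (l : ℕ → ℕ) (w : ℕ → ℕ × ℕ) : ℕ → ℤ
  | 0 => 0
  | n + 1 => (l n : ℤ) * py l w n + (w n).2

lemma Ln_succ (l : ℕ → ℕ) (n : ℕ) : Ln l (n + 1) = Ln l n * l n := by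
  simp [Ln, Finset.prod_range_succ]

lemma Ln_pos (l : ℕ → ℕ) (hl : ∀ m, 5 ≤ l m) (n : ℕ) : 0 < (Ln l n : ℝ) := by
  have : 0 < Ln l n := Finset.prod_pos fun k _ => by have := hl k; omega
  exact_mod_cast this

lemma Ln_ge (l : ℕ → ℕ) (hl : ∀ m, 5 ≤ l m) (n : ℕ) : (n : ℝ) + 1 ≤ (Ln l n : ℝ) := by
  induction n with
  | zero => simp [Ln]
  | succ n ih =>
    rw [Ln_succ]; push_cast
    have : (5:ℝ) ≤ l n := by exact_mod_cast hl n
    have h0 : (0:ℝ) ≤ n := by positivity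
    nlinarith

lemma wordMap_pt (q : Fin 3 → E2) (l : ℕ → ℕ) (hl : ∀ m, 5 ≤ l m) (w : ℕ → ℕ × ℕ) (n : ℕ)
    (a b : ℝ) : wordMap q l w n (pt q a b)
      = pt q ((px l w n + a) / Ln l n) ((py l w n + b) / Ln l n) := by
  induction n generalizing a b with
  | zero => simp [wordMap, px, py, Ln]
  | succ n ih =>
    have h0 : (l n : ℝ) ≠ 0 := by have := hl n; positivity
    have h1 := (Ln_pos l hl n).ne'
    have : fmap q (l n) (w n) (pt q a b)
        = pt q (((w n).1 + a) / l n) (((w n).2 + b) / l n) := by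
      unfold fmap pt
      simp only [div_eq_mul_inv]
      module
    simp only [wordMap, Function.comp, this, ih]
    rw [Ln_succ]
    congr 1 <;> simp only [px, py] <;> push_cast <;> field_simp <;> ring

lemma tri_eq (q : Fin 3 → E2) :
    Tri q = {y | ∃ a b : ℝ, 0 ≤ a ∧ 0 ≤ b ∧ a + b ≤ 1 ∧ y = pt q a b} := by
  apply Subset.antisymm
  · apply convexHull_min
    · rintro _ ⟨j, rfl⟩
      refine ⟨ex j, ey j, ?_, ?_, ?_, q_eq_pt q j⟩ <;> fin_cases j <;> simp [ex, ey]
    · rintro _ ⟨a, b, ha, hb, hab, rfl⟩ _ ⟨a', b', ha', hb', hab', rfl⟩ u v hu hv huv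
      refine ⟨u * a + v * a', u * b + v * b', by positivity, by positivity, ?_, ?_⟩
      · nlinarith
      · unfold pt
        have : u = 1 - v := by linarith
        subst this
        module
  · rintro _ ⟨a, b, ha, hb, hab, rfl⟩
    have hc := convex_convexHull ℝ (Set.range q)
    have := hc.sum_mem (t := Finset.univ) (w := ![1 - a - b, a, b]) (z := q)
      (by intro i _; fin_cases i <;> simp <;> linarith) (by simp [Fin.sum_univ_three]; ring)
      (fun i _ => subset_convexHull ℝ _ ⟨i, rfl⟩)
    simp only [Fin.sum_univ_three, Matrix.cons_val_zero, Matrix.cons_val_one, Matrix.cons_val] at this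
    have e : pt q a b = (1 - a - b) • q 0 + a • q 1 + b • q 2 := by
      unfold pt; module
    rw [e]; exact this

/-- The level-`n` triangle of a word. -/
def TT (q : Fin 3 → E2) (l : ℕ → ℕ) (n : ℕ) (w : ℕ → ℕ × ℕ) : Set E2 := wordMap q l w n '' Tri q

/-- corner `j` of the level-`n` triangle of `w`. -/
def cor (q : Fin 3 → E2) (l : ℕ → ℕ) (n : ℕ) (w : ℕ → ℕ × ℕ) (j : Fin 3) : E2 :=
  pt q (((px l w n + ex j : ℤ) : ℝ) / Ln l n) (((py l w n + ey j : ℤ) : ℝ) / Ln l n)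

lemma mem_TT (q : Fin 3 → E2) (l : ℕ → ℕ) (hl : ∀ m, 5 ≤ l m) (n : ℕ) (w : ℕ → ℕ × ℕ) (y : E2) :
    y ∈ TT q l n w ↔ ∃ a b : ℝ, 0 ≤ a ∧ 0 ≤ b ∧ a + b ≤ 1 ∧
      y = pt q ((px l w n + a) / Ln l n) ((py l w n + b) / Ln l n) := by
  rw [TT, tri_eq]
  constructor
  · rintro ⟨_, ⟨a, b, ha, hb, hab, rfl⟩, rfl⟩
    exact ⟨a, b, ha, hb, hab, wordMap_pt q l hl w n a b⟩
  · rintro ⟨a, b, ha, hb, hab, rfl⟩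
    exact ⟨_, ⟨a, b, ha, hb, hab, rfl⟩, wordMap_pt q l hl w n a b⟩

lemma cor_mem_TT (q : Fin 3 → E2) (l : ℕ → ℕ) (hl : ∀ m, 5 ≤ l m) (n : ℕ) (w : ℕ → ℕ × ℕ)
    (j : Fin 3) : cor q l n w j ∈ TT q l n w := by
  rw [mem_TT q l hl]
  refine ⟨ex j, ey j, ?_, ?_, ?_, by simp [cor]⟩ <;> fin_cases j <;> simp [ex, ey]

lemma overlap (q : Fin 3 → E2) (hq : ∀ j k : Fin 3, j ≠ k → dist (q j) (q k) = 1)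
    (l : ℕ → ℕ) (hl : ∀ m, 5 ≤ l m) (n : ℕ) (w w' : ℕ → ℕ × ℕ) (y : E2)
    (h : y ∈ TT q l n w) (h' : y ∈ TT q l n w')
    (hne : ¬ (px l w n = px l w' n ∧ py l w n = py l w' n)) :
    ∃ j j', px l w n + ex j = px l w' n + ex j' ∧ py l w n + ey j = py l w' n + ey j' ∧
      y = cor q l n w j ∧ y = cor q l n w' j' := by
  rw [mem_TT q l hl] at h h'
  obtain ⟨a, b, ha, hb, hab, rfl⟩ := h
  obtain ⟨a', b', ha', hb', hab', he⟩ := h'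
  have hL := Ln_pos l hl n
  obtain ⟨e1, e2⟩ := pt_inj q hq he
  rw [div_left_inj' hL.ne'] at e1 e2
  obtain ⟨D, hD⟩ : ∃ D : ℤ, px l w' n = px l w n + D := ⟨px l w' n - px l w n, by ring⟩
  obtain ⟨F, hF⟩ : ∃ F : ℤ, py l w' n = py l w n + F := ⟨py l w' n - py l w n, by ring⟩
  rw [hD] at e1; rw [hF] at e2
  push_cast at e1 e2
  have d1 : a = D + a' := by linarith
  have d2 : b = F + b' := by linarith
  have D1 : D ≤ 1 := by have : (D:ℝ) ≤ 1 := by linarith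
                        exact_mod_cast this
  have D2 : -1 ≤ D := by have : -1 ≤ (D:ℝ) := by linarith
                         exact_mod_cast this
  have F1 : F ≤ 1 := by have : (F:ℝ) ≤ 1 := by linarith
                        exact_mod_cast this
  have F2 : -1 ≤ F := by have : -1 ≤ (F:ℝ) := by linarith
                         exact_mod_cast this
  have S1 : D + F ≤ 1 := by have : (D:ℝ) + F ≤ 1 := by linarith
                            exact_mod_cast this
  have S2 : -1 ≤ D + F := by have : -1 ≤ (D:ℝ) + F := by linarith
                             exact_mod_cast this
  have key : ∃ j j', ex j = D + ex j' ∧ ey j = F + ey j' ∧ a = ex j ∧ b = ey j := by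
    obtain rfl | rfl | rfl : D = -1 ∨ D = 0 ∨ D = 1 := by omega
    all_goals obtain rfl | rfl | rfl : F = -1 ∨ F = 0 ∨ F = 1 := by omega
    all_goals push_cast at d1 d2
    · omega
    · exact ⟨0, 1, by simp [ex], by simp [ey], by simp [ex]; linarith, by simp [ey]; linarith⟩
    · exact ⟨2, 1, by simp [ex], by simp [ey], by simp [ex]; linarith, by simp [ey]; linarith⟩
    · exact ⟨0, 2, by simp [ex], by simp [ey], by simp [ex]; linarith, by simp [ey]; linarith⟩
    · exact absurd ⟨by omega, by omega⟩ hne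
    · exact ⟨2, 0, by simp [ex], by simp [ey], by simp [ex]; linarith, by simp [ey]; linarith⟩
    · exact ⟨1, 2, by simp [ex], by simp [ey], by simp [ex]; linarith, by simp [ey]; linarith⟩
    · exact ⟨1, 0, by simp [ex], by simp [ey], by simp [ex]; linarith, by simp [ey]; linarith⟩
    · omega
  obtain ⟨j, j', k1, k2, k3, k4⟩ := key
  refine ⟨j, j', by omega, by omega, ?_, ?_⟩
  · simp [cor, k3, k4]
  · have : px l w' n + ex j' = px l w n + ex j := by omega
    have h2 : py l w' n + ey j' = py l w n + ey j := by omega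
    rw [cor, this, h2]
    simp [k3, k4]

lemma px_congr (l : ℕ → ℕ) (w w' : ℕ → ℕ × ℕ) (n : ℕ) (h : ∀ k < n, w k = w' k) :
    px l w n = px l w' n ∧ py l w n = py l w' n := by
  induction n with
  | zero => simp [px, py]
  | succ n ih =>
    obtain ⟨h1, h2⟩ := ih fun k hk => h k (by omega)
    simp [px, py, h1, h2, h n (by omega)]

lemma pos_inj (l : ℕ → ℕ) (hl : ∀ m, 5 ≤ l m) (n : ℕ) (w w' : ℕ → ℕ × ℕ)
    (hw : ∀ k, k < n → w k ∈ Sset (l k)) (hw' : ∀ k, k < n → w' k ∈ Sset (l k))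
    (h1 : px l w n = px l w' n) (h2 : py l w n = py l w' n) : ∀ k < n, w k = w' k := by
  induction n with
  | zero => simp
  | succ n ih =>
    have a1 := (hw n (by omega)).1
    have a2 := (hw' n (by omega)).1
    have := hl n
    simp only [px, py] at h1 h2
    have key : ∀ (x y : ℤ) (a b : ℕ), a < l n → b < l n → (l n : ℤ) * x + a = l n * y + b →
        x = y ∧ a = b := by
      intro x y a b ha hb hh
      have ha' : ((l n : ℤ) * x + a) / l n = x := by
        rw [Int.add_comm, Int.add_mul_ediv_left _ _ (by omega), Int.ediv_eq_zero_of_lt (by omega) (by omega)]; ring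
      have hb' : ((l n : ℤ) * y + b) / l n = y := by
        rw [Int.add_comm, Int.add_mul_ediv_left _ _ (by omega), Int.ediv_eq_zero_of_lt (by omega) (by omega)]; ring
      have : x = y := by rw [← ha', ← hb', hh]
      subst this
      exact ⟨rfl, by omega⟩
    obtain ⟨b1, b2⟩ := key _ _ _ _ (by omega) (by omega) h1
    obtain ⟨c1, c2⟩ := key _ _ _ _ (by omega) (by omega) h2
    intro k hk
    by_cases hkn : k = n
    · subst hkn; exact Prod.ext b2 c2
    · exact ih (fun k hk => hw k (by omega)) (fun k hk => hw' k (by omega)) b1 c1 k (by omega)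

lemma pos_inj' (l : ℕ → ℕ) (hl : ∀ m, 5 ≤ l m) (n : ℕ) (w w' : ℕ → ℕ × ℕ)
    (hw : w ∈ Wn l n) (hw' : w' ∈ Wn l n)
    (h1 : px l w n = px l w' n) (h2 : py l w n = py l w' n) : w = w' := by
  funext k
  by_cases hk : k < n
  · exact pos_inj l hl n w w' hw.1 hw'.1 h1 h2 k hk
  · rw [hw.2 k (by omega), hw'.2 k (by omega)]

/-- child of a word -/
def ch (w : ℕ → ℕ × ℕ) (m : ℕ) (i : ℕ × ℕ) : ℕ → ℕ × ℕ := Function.update w m i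

lemma ch_mem (l : ℕ → ℕ) (m : ℕ) (w : ℕ → ℕ × ℕ) (hw : w ∈ Wn l m) (i : ℕ × ℕ)
    (hi : i ∈ Sset (l m)) : ch w m i ∈ Wn l (m + 1) := by
  constructor
  · intro k hk
    by_cases h : k = m
    · subst h; simpa [ch] using hi
    · simp only [ch, Function.update_of_ne h]; exact hw.1 k (by omega)
  · intro k hk
    simp only [ch, Function.update_of_ne (show k ≠ m by omega)]; exact hw.2 k (by omega)

lemma ch_pos (l : ℕ → ℕ) (m : ℕ) (w : ℕ → ℕ × ℕ) (i : ℕ × ℕ) :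
    px l (ch w m i) (m + 1) = l m * px l w m + i.1 ∧
    py l (ch w m i) (m + 1) = l m * py l w m + i.2 := by
  have := px_congr l (ch w m i) w m (fun k hk => by simp [ch, Function.update_of_ne hk.ne])
  simp only [px, py, this.1, this.2]
  simp [ch]

/-- every word of length `m+1` is a child. -/
lemma exists_ch (l : ℕ → ℕ) (m : ℕ) (w : ℕ → ℕ × ℕ) (hw : w ∈ Wn l (m + 1)) :
    ∃ v ∈ Wn l m, ∃ i ∈ Sset (l m), w = ch v m i := by
  refine ⟨Function.update w m (0, 0), ⟨?_, ?_⟩, w m, hw.1 m (by omega), ?_⟩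
  · intro k hk
    rw [Function.update_of_ne hk.ne]; exact hw.1 k (by omega)
  · intro k hk
    by_cases h : k = m
    · subst h; simp
    · rw [Function.update_of_ne h]; exact hw.2 k (by omega)
  · simp [ch]

lemma TT_ch_subset (q : Fin 3 → E2) (l : ℕ → ℕ) (hl : ∀ m, 5 ≤ l m) (m : ℕ) (w : ℕ → ℕ × ℕ)
    (i : ℕ × ℕ) (hi : i ∈ Sset (l m)) : TT q l (m + 1) (ch w m i) ⊆ TT q l m w := by
  intro y
  rw [mem_TT q l hl, mem_TT q l hl]
  rintro ⟨a, b, ha, hb, hab, rfl⟩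
  have h1 := hi.1
  have h5 := hl m
  have h1' : ((i.1 : ℝ) + i.2 + 1) ≤ l m := by
    have : i.1 + i.2 + 1 ≤ l m := by omega
    exact_mod_cast this
  have h0 : (0:ℝ) < l m := by positivity
  have hL := Ln_pos l hl m
  refine ⟨(i.1 + a) / l m, (i.2 + b) / l m, by positivity, by positivity, ?_, ?_⟩
  · rw [← add_div, div_le_one h0]; linarith
  · obtain ⟨e1, e2⟩ := ch_pos l m w i
    rw [e1, e2, Ln_succ]
    congr 1 <;> push_cast <;> field_simp <;> ring

lemma mem_Gasket (q : Fin 3 → E2) (l : ℕ → ℕ) (y : E2) :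
    y ∈ Gasket q l ↔ ∀ n, ∃ w ∈ Wn l n, y ∈ TT q l n w := by
  simp [Gasket, TT]

lemma cor_eq_of (q : Fin 3 → E2) (l : ℕ → ℕ) (n : ℕ) (w w' : ℕ → ℕ × ℕ) (j j' : Fin 3)
    (h1 : px l w n + ex j = px l w' n + ex j') (h2 : py l w n + ey j = py l w' n + ey j') :
    cor q l n w j = cor q l n w' j' := by
  rw [cor, cor, h1, h2]

/-- the corner child -/
def cc (l : ℕ) (j : Fin 3) : ℕ × ℕ := if j = 0 then (0, 0) else if j = 1 then (l - 1, 0) else (0, l - 1)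

lemma cc_mem (l : ℕ) (j : Fin 3) : cc l j ∈ Sset l := by
  fin_cases j <;> simp [cc, Sset]

lemma cor_cc (q : Fin 3 → E2) (l : ℕ → ℕ) (hl : ∀ m, 5 ≤ l m) (m : ℕ) (w : ℕ → ℕ × ℕ) (j : Fin 3) :
    cor q l (m + 1) (ch w m (cc (l m) j)) j = cor q l m w j := by
  have h5 := hl m
  have h0 : (0:ℝ) < l m := by positivity
  have hL := Ln_pos l hl m
  obtain ⟨e1, e2⟩ := ch_pos l m w (cc (l m) j)
  rw [cor, cor, e1, e2, Ln_succ]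
  have c1 : ((cc (l m) j).1 : ℤ) + ex j = l m * ex j := by
    fin_cases j <;> simp [cc, ex] <;> omega
  have c2 : ((cc (l m) j).2 : ℤ) + ey j = l m * ey j := by
    fin_cases j <;> simp [cc, ey] <;> omega
  rw [add_assoc, c1, add_assoc, c2]
  congr 1 <;> push_cast <;> field_simp

/-- a point of `K ∩ TT w` lies in a child triangle. -/
lemma exists_child (q : Fin 3 → E2) (hq : ∀ j k : Fin 3, j ≠ k → dist (q j) (q k) = 1)
    (l : ℕ → ℕ) (hl : ∀ m, 5 ≤ l m) (m : ℕ) (w : ℕ → ℕ × ℕ) (hw : w ∈ Wn l m) (y : E2)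
    (hy : y ∈ Gasket q l) (hyw : y ∈ TT q l m w) :
    ∃ i ∈ Sset (l m), y ∈ TT q l (m + 1) (ch w m i) := by
  obtain ⟨w', hw', hy'⟩ := (mem_Gasket q l y).1 hy (m + 1)
  obtain ⟨v, hv, i, hi, rfl⟩ := exists_ch l m w' hw'
  by_cases hvw : v = w
  · subst hvw; exact ⟨i, hi, hy'⟩
  · have := overlap q hq l hl m w v y hyw (TT_ch_subset q l hl m v i hi hy')
      (fun h => hvw (pos_inj' l hl m w v hw hv h.1 h.2).symm)
    obtain ⟨j, j', -, -, h, -⟩ := this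
    refine ⟨cc (l m) j, cc_mem _ _, ?_⟩
    rw [h, ← cor_cc q l hl m w j]
    exact cor_mem_TT q l hl _ _ _

end

section
/-- cyclic enumeration of the cells -/
def ringE (l t : ℕ) : ℕ × ℕ :=
  if t < l - 1 then (t, 0) else if t < 2 * (l - 1) then (2 * (l - 1) - t, t - (l - 1))
  else (0, 3 * (l - 1) - t)

lemma ringE_mem (l t : ℕ) (hl : 5 ≤ l) (ht : t < 3 * l - 3) : ringE l t ∈ Sset l := by
  unfold ringE
  split_ifs
  · exact ⟨by simp; omega, by simp⟩
  · refine ⟨by simp; omega, ?_⟩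
    have : l - 1 - (2 * (l - 1) - t) - (t - (l - 1)) = 0 := by omega
    simp only [this, mul_zero]
  · exact ⟨by simp; omega, by simp⟩

lemma ringE_surj (l : ℕ) (hl : 5 ≤ l) (i : ℕ × ℕ) (hi : i ∈ Sset l) :
    ∃ t < 3 * l - 3, ringE l t = i := by
  obtain ⟨a, b⟩ := i
  obtain ⟨h1, h2⟩ := hi
  simp only [Nat.mul_eq_zero] at h1 h2
  by_cases hb : b = 0
  · subst hb
    exact ⟨a, by omega, by unfold ringE; split_ifs <;> ext <;> simp <;> omega⟩
  · by_cases hab : a + b = l - 1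
    · exact ⟨l - 1 + b, by omega, by unfold ringE; split_ifs <;> ext <;> simp <;> omega⟩
    · exact ⟨3 * (l - 1) - b, by omega, by unfold ringE; split_ifs <;> ext <;> simp <;> omega⟩

lemma ringE_inj (l s t : ℕ) (hl : 5 ≤ l) (hs : s < 3 * l - 3) (ht : t < 3 * l - 3)
    (h : ringE l s = ringE l t) : s = t := by
  unfold ringE at h
  split_ifs at h <;> simp only [Prod.mk.injEq] at h <;> omega

open Classical in
/-- the finset of words -/
def WF (l : ℕ → ℕ) : ℕ → Finset (ℕ → ℕ × ℕ)
  | 0 => {fun _ => (0, 0)}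
  | n + 1 => (WF l n ×ˢ Finset.range (3 * l n - 3)).image fun p => ch p.1 n (ringE (l n) p.2)

lemma mem_WF (l : ℕ → ℕ) (hl : ∀ m, 5 ≤ l m) (n : ℕ) (w : ℕ → ℕ × ℕ) :
    w ∈ WF l n ↔ w ∈ Wn l n := by
  induction n generalizing w with
  | zero => 
    simp only [WF, Finset.mem_singleton, Wn, mem_ofPred_eq]
    constructor
    · rintro rfl; simp
    · rintro ⟨-, h⟩; funext k; exact h k (by omega)
  | succ n ih =>
    simp only [WF, Finset.mem_image, Finset.mem_product, Finset.mem_range, Prod.exists]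
    constructor
    · rintro ⟨v, t, ⟨hv, ht⟩, rfl⟩
      exact ch_mem l n v ((ih v).1 hv) _ (ringE_mem _ _ (hl n) ht)
    · intro hw
      obtain ⟨v, hv, i, hi, rfl⟩ := exists_ch l n w hw
      obtain ⟨t, ht, rfl⟩ := ringE_surj _ (hl n) i hi
      exact ⟨v, t, ⟨(ih v).2 hv, ht⟩, rfl⟩

open Classical in
lemma card_WF (l : ℕ → ℕ) (n : ℕ) : (WF l n).card ≤ Mn l n := by
  induction n with
  | zero => simp [WF, Mn]
  | succ n ih =>
    calc _ ≤ (WF l n ×ˢ Finset.range (3 * l n - 3)).card := Finset.card_image_le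
      _ = (WF l n).card * (3 * l n - 3) := by simp
      _ ≤ Mn l n * (3 * l n - 3) := by gcongr
      _ = _ := by simp [Mn, Finset.prod_range_succ]

lemma isCompact_TT (q : Fin 3 → E2) (l : ℕ → ℕ) (n : ℕ) (w : ℕ → ℕ × ℕ) :
    IsCompact (TT q l n w) := by
  have hc : Continuous (wordMap q l w n) := by
    induction n with
    | zero => exact continuous_id
    | succ n ih =>
      refine ih.comp ?_
      unfold fmap; fun_prop
  exact ((Set.finite_range q).isCompact_convexHull ℝ).image hc

lemma isCompact_Gasket (q : Fin 3 → E2) (l : ℕ → ℕ) (hl : ∀ m, 5 ≤ l m) :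
    IsCompact (Gasket q l) := by
  have h : ∀ n, IsCompact (⋃ w ∈ Wn l n, TT q l n w) := by
    intro n
    have hf : (Wn l n).Finite := (WF l n).finite_toSet.subset fun w hw => (mem_WF l hl n w).2 hw
    exact hf.isCompact_biUnion fun w _ => isCompact_TT q l n w
  exact (h 0).of_isClosed_subset (isClosed_iInter fun n => (h n).isClosed) (iInter_subset _ 0)

/-- `x`, `y` are joined by a path in `K` of length at most `T` -/
def Reach (q : Fin 3 → E2) (l : ℕ → ℕ) (x y : E2) (T : ℝ) : Prop :=
  0 ≤ T ∧ ∃ γ : ℝ → E2, (∀ s t, dist (γ s) (γ t) ≤ |s - t|) ∧ (∀ t, γ t ∈ Gasket q l) ∧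
    γ 0 = x ∧ γ T = y

variable {q : Fin 3 → E2} {l : ℕ → ℕ}

lemma Reach.refl {x : E2} (hx : x ∈ Gasket q l) {T : ℝ} (hT : 0 ≤ T) : Reach q l x x T :=
  ⟨hT, fun _ => x, by simp, fun _ => hx, rfl, rfl⟩

lemma Reach.symm {x y : E2} {T : ℝ} (h : Reach q l x y T) : Reach q l y x T := by
  obtain ⟨hT, γ, h1, h2, h3, h4⟩ := h
  refine ⟨hT, fun t => γ (T - t), fun s t => ?_, fun t => h2 _, by simpa, by simpa⟩
  refine (h1 _ _).trans (le_of_eq ?_)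
  rw [show T - s - (T - t) = -(s - t) by ring, abs_neg]

lemma Reach.trans {x y z : E2} {S T : ℝ} (h : Reach q l x y S) (h' : Reach q l y z T) :
    Reach q l x z (S + T) := by
  obtain ⟨hS, γ, h1, h2, h3, h4⟩ := h
  obtain ⟨hT, δ, k1, k2, k3, k4⟩ := h'
  refine ⟨by linarith, fun t => if t ≤ S then γ t else δ (t - S), ?_, ?_, ?_, ?_⟩
  · have key : ∀ s t, s ≤ t → dist (if s ≤ S then γ s else δ (s - S))
        (if t ≤ S then γ t else δ (t - S)) ≤ t - s := by
      intro s t hst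
      split_ifs with a b b
      · have := h1 s t; rwa [abs_of_nonpos (by linarith), neg_sub] at this
      · have e1 := h1 s S
        have e2 := k1 0 (t - S)
        rw [abs_of_nonpos (by linarith)] at e1 e2
        rw [h4] at e1; rw [k3] at e2
        linarith [dist_triangle (γ s) y (δ (t - S))]
      · linarith
      · have := k1 (s - S) (t - S)
        rw [abs_of_nonpos (by linarith)] at this; linarith
    intro s t
    rcases le_total s t with hst | hst
    · rw [abs_of_nonpos (by linarith), neg_sub]; exact key s t hst
    · rw [abs_of_nonneg (by linarith), dist_comm]; exact key t s hst
  · intro t; dsimp only; split_ifs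
    exacts [h2 _, k2 _]
  · simp [hS, h3]
  · dsimp only
    split_ifs with h
    · have : T = 0 := by linarith
      subst this
      rw [add_zero, h4, ← k4, k3]
    · simpa using k4

lemma Reach.mem_right {x y : E2} {S : ℝ} (h : Reach q l x y S) : y ∈ Gasket q l := by
  obtain ⟨hS, γ, h1, h2, h3, h4⟩ := h
  rw [← h4]; exact h2 _

lemma Reach.mono {x y : E2} {S T : ℝ} (h : Reach q l x y S) (hST : S ≤ T) :
    Reach q l x y T := by
  have := h.trans (Reach.refl h.mem_right (sub_nonneg.2 hST))
  simpa using this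

lemma Reach.limit (hl : ∀ m, 5 ≤ l m) {x y : E2} {T : ℝ}
    (h : ∀ ε > 0, ∃ y', dist y' y < ε ∧ Reach q l x y' T) : Reach q l x y T := by
  have hK := isCompact_Gasket q l hl
  have h' : ∀ n : ℕ, ∃ y', dist y' y < 1 / ((n : ℝ) + 1) ∧ Reach q l x y' T :=
    fun n => h _ (by positivity)
  choose Y hY hR using h'
  have hT := (hR 0).1
  choose _ γ h1 h2 h3 h4 using hR
  have hlim : ∀ t, ∃ z ∈ Gasket q l, Tendsto (fun n => γ n t) (hyperfilter ℕ : Filter ℕ) (nhds z) := by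
    intro t
    have := hK.ultrafilter_le_nhds ((hyperfilter ℕ).map fun n => γ n t) (by
      rw [Filter.le_principal_iff]
      exact Filter.mem_map.2 (Filter.univ_mem' fun n => h2 n t))
    obtain ⟨z, hz, hz'⟩ := this
    exact ⟨z, hz, hz'⟩
  choose δ hδ hδ' using hlim
  have hle : (hyperfilter ℕ : Filter ℕ) ≤ atTop := by
    have := @hyperfilter_le_cofinite ℕ _
    rwa [Nat.cofinite_eq_atTop] at this
  refine ⟨hT, δ, ?_, hδ, ?_, ?_⟩
  · intro s t
    exact le_of_tendsto ((hδ' s).dist (hδ' t)) (Eventually.of_forall fun n => h1 n s t)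
  · refine tendsto_nhds_unique (hδ' 0) ?_
    simp only [h3]; exact tendsto_const_nhds
  · refine tendsto_nhds_unique (hδ' T) ?_
    simp only [h4]
    refine Tendsto.mono_left ?_ hle
    rw [tendsto_iff_dist_tendsto_zero]
    exact squeeze_zero (fun _ => dist_nonneg) (fun n => (hY n).le) tendsto_one_div_add_atTop_nhds_zero_nat

lemma Reach.pdist_le {x y : E2} {T : ℝ} (h : Reach q l x y T) :
    pdist q l x y ≤ ENNReal.ofReal T := by
  obtain ⟨hT, γ, h1, h2, h3, h4⟩ := h
  have hL : LipschitzWith 1 γ := LipschitzWith.of_dist_le_mul fun s t => by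
    simpa [Real.dist_eq] using h1 s t
  unfold pdist
  refine (iInf₂_le (γ ∘ fun t => T * t) ?_).trans ((iInf₂_le ?_ ?_).trans ((iInf_le _ ?_).trans ?_))
  · exact (hL.continuous.comp (by fun_prop)).continuousOn
  · intro t _; exact h2 _
  · simpa
  · simpa
  · have := hL.lipschitzOnWith (s := univ) |>.comp_eVariationOn_le (g := fun t => T * t) (s := Icc 0 1)
      (fun _ _ => mem_univ _)
    refine this.trans ?_
    simp only [ENNReal.coe_one, one_mul]
    have hm : MonotoneOn (fun t => T * t) (Icc (0:ℝ) 1) := fun a _ b _ hab =>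
      mul_le_mul_of_nonneg_left hab hT
    have := (hm.eVariationOn_eq (a := 0) (b := 1) (by simp) (by simp)).le
    simpa using this

lemma Reach.gdist_lt {x y : E2} {T s : ℝ} (h : Reach q l x y T) (hs : T < s) :
    gdist q l x y < s := by
  have := ENNReal.toReal_mono (by simp) h.pdist_le
  rw [ENNReal.toReal_ofReal h.1] at this
  exact lt_of_le_of_lt this hs

end

section
variable {q : Fin 3 → E2} {l : ℕ → ℕ}

/-- point on the edge from corner `i` to corner `j` -/
def edgePt (q : Fin 3 → E2) (l : ℕ → ℕ) (m : ℕ) (w : ℕ → ℕ × ℕ) (i j : Fin 3) (θ : ℝ) : E2 :=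
  pt q ((px l w m + ((1 - θ) * ex i + θ * ex j)) / Ln l m)
    ((py l w m + ((1 - θ) * ey i + θ * ey j)) / Ln l m)

lemma edgePt_mem_TT (hl : ∀ m, 5 ≤ l m) (m : ℕ) (w : ℕ → ℕ × ℕ) (i j : Fin 3) (θ : ℝ)
    (h0 : 0 ≤ θ) (h1 : θ ≤ 1) : edgePt q l m w i j θ ∈ TT q l m w := by
  rw [mem_TT q l hl]
  refine ⟨_, _, ?_, ?_, ?_, rfl⟩ <;> fin_cases i <;> fin_cases j <;> simp [ex, ey] <;> linarith

lemma edgePt_child (hl : ∀ m, 5 ≤ l m) (m : ℕ) (w : ℕ → ℕ × ℕ) (i j : Fin 3) (θ : ℝ)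
    (h0 : 0 ≤ θ) (h1 : θ ≤ 1) : ∃ c ∈ Sset (l m), ∃ θ', 0 ≤ θ' ∧ θ' ≤ 1 ∧
      edgePt q l m w i j θ = edgePt q l (m + 1) (ch w m c) i j θ' := by
  have h5 := hl m
  have hlp : (0:ℝ) < l m := by positivity
  have hL := Ln_pos l hl m
  obtain ⟨s, hs, hs0, hs1⟩ : ∃ s : ℕ, s ≤ l m - 1 ∧ (s : ℝ) ≤ l m * θ ∧ l m * θ ≤ s + 1 := by
    by_cases h : θ = 1
    · refine ⟨l m - 1, le_rfl, ?_, ?_⟩ <;> rw [Nat.cast_sub (by omega)] <;> subst h <;> simp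
    · have hlt : θ < 1 := lt_of_le_of_ne h1 h
      refine ⟨⌊l m * θ⌋₊, ?_, Nat.floor_le (by positivity), (Nat.lt_floor_add_one _).le⟩
      have : ⌊l m * θ⌋₊ < l m := by
        rw [Nat.floor_lt (by positivity)]; nlinarith
      omega
  obtain ⟨u, hu⟩ : ∃ u : ℕ, u + s = l m - 1 := ⟨l m - 1 - s, by omega⟩
  have hur : (u : ℝ) + s = l m - 1 := by
    have : u + s + 1 = l m := by omega
    rw [← this]; push_cast; ring
  refine ⟨(u * (ex i).toNat + s * (ex j).toNat, u * (ey i).toNat + s * (ey j).toNat), ?_,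
    l m * θ - s, by linarith, by linarith, ?_⟩
  · rw [Sset]
    fin_cases i <;> fin_cases j <;> simp [ex, ey] <;> omega
  · have E := ch_pos l m w (u * (ex i).toNat + s * (ex j).toNat, u * (ey i).toNat + s * (ey j).toNat)
    have a1 : (((ex i).toNat : ℕ) : ℝ) = ex i := by fin_cases i <;> simp [ex]
    have a2 : (((ex j).toNat : ℕ) : ℝ) = ex j := by fin_cases j <;> simp [ex]
    have a3 : (((ey i).toNat : ℕ) : ℝ) = ey i := by fin_cases i <;> simp [ey]
    have a4 : (((ey j).toNat : ℕ) : ℝ) = ey j := by fin_cases j <;> simp [ey]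
    have hu' : (u : ℝ) = l m - 1 - s := by linarith
    rw [edgePt, edgePt, E.1, E.2, Ln_succ]
    simp only [Int.cast_add, Int.cast_mul, Int.cast_natCast, Nat.cast_add, Nat.cast_mul, a1, a2, a3, a4, hu']
    congr 1 <;> field_simp <;> ring

lemma TT_nested (hl : ∀ m, 5 ≤ l m) (m r : ℕ) (w : ℕ → ℕ × ℕ) (hw : w ∈ Wn l (m + r)) :
    ∃ v ∈ Wn l m, TT q l (m + r) w ⊆ TT q l m v := by
  induction r generalizing w with
  | zero => exact ⟨w, hw, le_rfl⟩
  | succ r ih =>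
    obtain ⟨v, hv, i, hi, rfl⟩ := exists_ch l (m + r) w hw
    obtain ⟨v', h1, h2⟩ := ih v hv
    exact ⟨v', h1, (TT_ch_subset q l hl (m + r) v i hi).trans h2⟩

lemma edgePt_mem_Gasket (hl : ∀ m, 5 ≤ l m) (m : ℕ) (w : ℕ → ℕ × ℕ) (hw : w ∈ Wn l m)
    (i j : Fin 3) (θ : ℝ) (h0 : 0 ≤ θ) (h1 : θ ≤ 1) : edgePt q l m w i j θ ∈ Gasket q l := by
  have key : ∀ r, ∃ w' ∈ Wn l (m + r), ∃ θ', 0 ≤ θ' ∧ θ' ≤ 1 ∧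
      edgePt q l m w i j θ = edgePt q l (m + r) w' i j θ' := by
    intro r
    induction r with
    | zero => exact ⟨w, hw, θ, h0, h1, rfl⟩
    | succ r ih =>
      obtain ⟨w', hw', θ', a, b, e⟩ := ih
      obtain ⟨c, hc, θ'', a', b', e'⟩ := edgePt_child (q := q) hl (m + r) w' i j θ' a b
      exact ⟨ch w' (m + r) c, ch_mem l _ _ hw' _ hc, θ'', a', b', e.trans e'⟩
  rw [mem_Gasket]
  intro n
  obtain ⟨w', hw', θ', a, b, e⟩ := key n
  rw [e]
  have hw2 : w' ∈ Wn l (n + m) := by rwa [add_comm]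
  obtain ⟨v, hv, hs⟩ := TT_nested (q := q) hl n m w' hw2
  refine ⟨v, hv, hs ?_⟩
  rw [add_comm n m]
  exact edgePt_mem_TT hl _ _ _ _ _ a b

lemma cor_dist (hq : ∀ j k : Fin 3, j ≠ k → dist (q j) (q k) = 1) (hl : ∀ m, 5 ≤ l m)
    (m : ℕ) (w : ℕ → ℕ × ℕ) (i j : Fin 3) (hij : i ≠ j) :
    dist (cor q l m w i) (cor q l m w j) = 1 / Ln l m := by
  have hL := Ln_pos l hl m
  rw [← sq_eq_sq₀ dist_nonneg (by positivity), cor, cor, pt_dist_sq q hq]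
  push_cast
  fin_cases i <;> fin_cases j <;> simp [ex, ey] at hij ⊢ <;> field_simp <;> ring

lemma cor_mem (hl : ∀ m, 5 ≤ l m) (m : ℕ) (w : ℕ → ℕ × ℕ) (hw : w ∈ Wn l m)
    (i : Fin 3) : cor q l m w i ∈ Gasket q l := by
  have := edgePt_mem_Gasket (q := q) hl m w hw i i 0 le_rfl zero_le_one
  simpa [edgePt, cor] using this

lemma reach_edge (hq : ∀ j k : Fin 3, j ≠ k → dist (q j) (q k) = 1) (hl : ∀ m, 5 ≤ l m)
    (m : ℕ) (w : ℕ → ℕ × ℕ) (hw : w ∈ Wn l m) (i j : Fin 3) :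
    Reach q l (cor q l m w i) (cor q l m w j) (1 / Ln l m) := by
  have hL := Ln_pos l hl m
  by_cases hij : i = j
  · subst hij; exact Reach.refl (cor_mem hl m w hw i) (by positivity)
  refine ⟨by positivity, fun t => edgePt q l m w i j (max 0 (min 1 (Ln l m * t))), ?_, ?_, ?_, ?_⟩
  · have hlin : ∀ θ θ', dist (edgePt q l m w i j θ) (edgePt q l m w i j θ') = |θ - θ'| / Ln l m := by
      intro θ θ'
      rw [← sq_eq_sq₀ dist_nonneg (by positivity), edgePt, edgePt, pt_dist_sq q hq, div_pow, sq_abs]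
      fin_cases i <;> fin_cases j <;> simp [ex, ey] at hij ⊢ <;> field_simp <;> ring
    intro s t
    rw [hlin, div_le_iff₀ hL]
    have : |s - t| * Ln l m = |Ln l m * s - Ln l m * t| := by
      rw [← mul_sub, abs_mul, abs_of_pos hL]; ring
    rw [this]
    have h1 := abs_max_sub_max_le_max 0 (min 1 (Ln l m * s)) 0 (min 1 (Ln l m * t))
    have h2 := abs_min_sub_min_le_max 1 (Ln l m * s) 1 (Ln l m * t)
    simp only [sub_self, abs_zero] at h1 h2
    exact (h1.trans (max_le (abs_nonneg _) le_rfl)).trans (h2.trans (max_le (abs_nonneg _) le_rfl))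
  · intro t
    exact edgePt_mem_Gasket hl m w hw _ _ _ (le_max_left _ _)
      (max_le zero_le_one (min_le_left _ _))
  · simp [edgePt, cor]
  · have : (Ln l m : ℝ) * (1 / Ln l m) = 1 := by field_simp
    simp only [this, min_self]
    simp [edgePt, cor]

/-- entry / exit corners of ring cells -/
def rEnt (l t : ℕ) : Fin 3 :=
  if t = 0 then 2 else if t ≤ l - 1 then 0 else if t ≤ 2 * (l - 1) then 1 else 2
def rExt (l t : ℕ) : Fin 3 :=
  if t < l - 1 then 1 else if t < 2 * (l - 1) then 2 else 0

def rc (l : ℕ → ℕ) (w : ℕ → ℕ × ℕ) (m t : ℕ) : ℕ → ℕ × ℕ := ch w m (ringE (l m) (t % (3 * l m - 3)))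
def ent (q : Fin 3 → E2) (l : ℕ → ℕ) (w : ℕ → ℕ × ℕ) (m t : ℕ) : E2 :=
  cor q l (m + 1) (rc l w m t) (rEnt (l m) (t % (3 * l m - 3)))
def ext (q : Fin 3 → E2) (l : ℕ → ℕ) (w : ℕ → ℕ × ℕ) (m t : ℕ) : E2 :=
  cor q l (m + 1) (rc l w m t) (rExt (l m) (t % (3 * l m - 3)))

lemma rc_mem (hl : ∀ m, 5 ≤ l m) (w : ℕ → ℕ × ℕ) (m t : ℕ) (hw : w ∈ Wn l m) :
    rc l w m t ∈ Wn l (m + 1) :=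
  ch_mem l m w hw _ (ringE_mem _ _ (hl m) (Nat.mod_lt _ (by have := hl m; omega)))

lemma ring_next (l t t' : ℕ) (hl : 5 ≤ l) (ht : t < 3 * l - 3)
    (ht' : t' = if t + 1 = 3 * l - 3 then 0 else t + 1) :
    ((ringE l t).1 : ℤ) + ex (rExt l t) = (ringE l t').1 + ex (rEnt l t') ∧
    ((ringE l t).2 : ℤ) + ey (rExt l t) = (ringE l t').2 + ey (rEnt l t') := by
  unfold ringE rExt rEnt
  split_ifs at ht' ⊢ <;> simp [ex, ey] <;> omega

lemma ext_eq_ent (hl : ∀ m, 5 ≤ l m) (w : ℕ → ℕ × ℕ) (m t : ℕ) :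
    ext q l w m t = ent q l w m (t + 1) := by
  have h5 := hl m
  have hN : 0 < 3 * l m - 3 := by omega
  have := ring_next (l m) (t % (3 * l m - 3)) ((t + 1) % (3 * l m - 3)) h5 (Nat.mod_lt _ hN) (by
    have hlt := Nat.mod_lt t hN
    rw [Nat.add_mod]
    rw [Nat.mod_eq_of_lt (show 1 < 3 * l m - 3 by omega)]
    split_ifs with h
    · rw [h]; simp
    · exact Nat.mod_eq_of_lt (by omega))
  apply cor_eq_of
  · rw [rc, rc, (ch_pos l m w _).1, (ch_pos l m w _).1]; linarith [this.1]
  · rw [rc, rc, (ch_pos l m w _).2, (ch_pos l m w _).2]; linarith [this.2]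

/-- ring position of corner `c` -/
lemma rc_cc (hl : ∀ m, 5 ≤ l m) (w : ℕ → ℕ × ℕ) (m : ℕ) (c : Fin 3) :
    rc l w m (c.val * (l m - 1)) = ch w m (cc (l m) c) := by
  have h5 := hl m
  rw [rc, Nat.mod_eq_of_lt (by have := c.isLt; fin_cases c <;> simp <;> omega)]
  congr 1
  fin_cases c <;> simp [ringE, cc] <;> (try split_ifs) <;> (try ext) <;> simp <;> omega

lemma exists_rc (hq : ∀ j k : Fin 3, j ≠ k → dist (q j) (q k) = 1) (hl : ∀ m, 5 ≤ l m)
    (w : ℕ → ℕ × ℕ) (m : ℕ) (hw : w ∈ Wn l m) (y : E2) (hy : y ∈ Gasket q l)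
    (hyw : y ∈ TT q l m w) (t0 : ℕ) :
    ∃ j < 3 * l m - 3, y ∈ TT q l (m + 1) (rc l w m (t0 + j)) := by
  have h5 := hl m
  have hN : 0 < 3 * l m - 3 := by omega
  obtain ⟨i, hi, h⟩ := exists_child q hq l hl m w hw y hy hyw
  obtain ⟨t, ht, rfl⟩ := ringE_surj _ h5 i hi
  set N := 3 * l m - 3 with hNdef
  have h0 := Nat.mod_lt t0 hN
  refine ⟨(t + (N - t0 % N)) % N, Nat.mod_lt _ hN, ?_⟩
  have : (t0 + (t + (N - t0 % N)) % N) % N = t := by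
    rw [Nat.add_mod, Nat.mod_mod, ← Nat.add_mod]
    have e : t0 + (t + (N - t0 % N)) = t + N * (t0 / N + 1) := by
      have := Nat.div_add_mod t0 N
      rw [mul_add]; omega
    rw [e, Nat.add_mul_mod_self_left, Nat.mod_eq_of_lt ht]
  rw [rc, ← hNdef, this]; exact h

lemma reach_chain (hq : ∀ j k : Fin 3, j ≠ k → dist (q j) (q k) = 1) (hl : ∀ m, 5 ≤ l m)
    (w : ℕ → ℕ × ℕ) (m : ℕ) (hw : w ∈ Wn l m) (t j : ℕ) :
    Reach q l (ext q l w m t) (ent q l w m (t + (j + 1))) (j / Ln l (m + 1)) := by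
  induction j with
  | zero =>
    rw [ext_eq_ent hl]
    have h : Reach q l (ent q l w m (t + 1)) (ent q l w m (t + 1)) 0 :=
      Reach.refl (cor_mem hl (m + 1) _ (rc_mem hl w m _ hw) _) le_rfl
    simpa using h
  | succ j ih =>
    have h := reach_edge hq hl (m + 1) _ (rc_mem hl w m (t + (j + 1)) hw)
      (rEnt (l m) ((t + (j + 1)) % (3 * l m - 3))) (rExt (l m) ((t + (j + 1)) % (3 * l m - 3)))
    have h' := ih.trans h
    have e : ext q l w m (t + (j + 1)) = ent q l w m (t + (j + 1 + 1)) := ext_eq_ent hl w m _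
    rw [← e]
    refine h'.mono (le_of_eq ?_)
    push_cast; ring

lemma rc_add_N (w : ℕ → ℕ × ℕ) (m t : ℕ) : rc l w m (t + (3 * l m - 3)) = rc l w m t := by
  simp [rc]

/-- from corner `c` forward -/
lemma reach_fwd (hq : ∀ j k : Fin 3, j ≠ k → dist (q j) (q k) = 1) (hl : ∀ m, 5 ≤ l m)
    (w : ℕ → ℕ × ℕ) (m : ℕ) (hw : w ∈ Wn l m) (c : Fin 3) (t : ℕ)
    (ht : rc l w m t = ch w m (cc (l m) c)) (j : ℕ) (hj : 1 ≤ j) :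
    Reach q l (cor q l m w c) (ent q l w m (t + j)) (j / Ln l (m + 1)) := by
  obtain ⟨j, rfl⟩ : ∃ i, j = i + 1 := ⟨j - 1, by omega⟩
  have h1 := reach_edge hq hl (m + 1) _ (rc_mem hl w m t hw) c (rExt (l m) (t % (3 * l m - 3)))
  have h2 := reach_chain hq hl w m hw t j
  have e : cor q l (m + 1) (rc l w m t) c = cor q l m w c := by rw [ht, cor_cc q l hl]
  rw [e] at h1
  refine (h1.trans h2).mono (le_of_eq ?_)
  push_cast; ring

/-- from corner `c` backward -/
lemma reach_bwd (hq : ∀ j k : Fin 3, j ≠ k → dist (q j) (q k) = 1) (hl : ∀ m, 5 ≤ l m)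
    (w : ℕ → ℕ × ℕ) (m : ℕ) (hw : w ∈ Wn l m) (c : Fin 3) (t : ℕ)
    (j : ℕ) (hj : 1 ≤ j) (ht : rc l w m (t + j) = ch w m (cc (l m) c)) :
    Reach q l (cor q l m w c) (ext q l w m t) (j / Ln l (m + 1)) := by
  obtain ⟨j, rfl⟩ : ∃ i, j = i + 1 := ⟨j - 1, by omega⟩
  have h1 := reach_edge hq hl (m + 1) _ (rc_mem hl w m (t + (j + 1)) hw) c
    (rEnt (l m) ((t + (j + 1)) % (3 * l m - 3)))
  have h2 := (reach_chain hq hl w m hw t j).symm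
  have e : cor q l (m + 1) (rc l w m (t + (j + 1))) c = cor q l m w c := by rw [ht, cor_cc q l hl]
  rw [e] at h1
  refine (h1.trans h2).mono (le_of_eq ?_)
  push_cast; ring

end

section
variable {q : Fin 3 → E2} {l : ℕ → ℕ}

lemma cor_near (hq : ∀ j k : Fin 3, j ≠ k → dist (q j) (q k) = 1) (hl : ∀ m, 5 ≤ l m)
    (m : ℕ) (w : ℕ → ℕ × ℕ) (y : E2) (hy : y ∈ TT q l m w) (c : Fin 3) :
    dist (cor q l m w c) y ≤ 2 / Ln l m := by
  obtain ⟨a, b, ha, hb, hab, rfl⟩ := (mem_TT q l hl m w y).1 hy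
  have hL := Ln_pos l hl m
  refine (pt_dist_le q hq _ _ _ _).trans ?_
  rw [← sub_div, ← sub_div, abs_div, abs_div, abs_of_pos hL, ← add_div]
  gcongr
  push_cast
  have h1 : |(px l w m : ℝ) + ex c - (px l w m + a)| ≤ 1 := by
    rw [abs_le]; fin_cases c <;> simp [ex] <;> constructor <;> linarith
  have h2 : |(py l w m : ℝ) + ey c - (py l w m + b)| ≤ 1 := by
    rw [abs_le]; fin_cases c <;> simp [ey] <;> constructor <;> linarith
  linarith

lemma step_fwd (hq : ∀ j k : Fin 3, j ≠ k → dist (q j) (q k) = 1) (hl : ∀ m, 5 ≤ l m)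
    (w : ℕ → ℕ × ℕ) (m : ℕ) (hw : w ∈ Wn l m) (c : Fin 3) (t : ℕ)
    (ht : rc l w m t = ch w m (cc (l m) c)) (j : ℕ) (y : E2) (T : ℝ)
    (H : ∀ c', Reach q l (cor q l (m + 1) (rc l w m (t + j)) c') y T) :
    Reach q l (cor q l m w c) y (j / Ln l (m + 1) + T) := by
  rcases Nat.eq_zero_or_pos j with rfl | hj
  · have := H c
    rw [add_zero, ht, cor_cc q l hl] at this
    simpa using this
  · exact (reach_fwd hq hl w m hw c t ht j hj).trans (H _)

lemma step_bwd (hq : ∀ j k : Fin 3, j ≠ k → dist (q j) (q k) = 1) (hl : ∀ m, 5 ≤ l m)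
    (w : ℕ → ℕ × ℕ) (m : ℕ) (hw : w ∈ Wn l m) (c : Fin 3) (t : ℕ) (j : ℕ)
    (ht : rc l w m (t + j) = ch w m (cc (l m) c)) (y : E2) (T : ℝ)
    (H : ∀ c', Reach q l (cor q l (m + 1) (rc l w m t) c') y T) :
    Reach q l (cor q l m w c) y (j / Ln l (m + 1) + T) := by
  rcases Nat.eq_zero_or_pos j with rfl | hj
  · have := H c
    rw [add_zero] at ht
    rw [ht, cor_cc q l hl] at this
    simpa using this
  · exact (reach_bwd hq hl w m hw c t j hj ht).trans (H _)

lemma approx_eps (hl : ∀ m, 5 ≤ l m) (m : ℕ) (ε : ℝ) (hε : 0 < ε) :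
    ∃ r, (2 : ℝ) / Ln l (m + r) < ε := by
  obtain ⟨r, hr⟩ := exists_nat_gt (2 / ε)
  refine ⟨r, ?_⟩
  have h := Ln_ge l hl (m + r)
  push_cast at h
  have h0 : (0:ℝ) ≤ m := by positivity
  rw [div_lt_iff₀ (Ln_pos l hl _)]
  rw [div_lt_iff₀ hε] at hr
  nlinarith

lemma delta_ineq (l j N L' : ℝ) (hL : 0 < L') (h0 : 0 < l) (h : 2 * j + 3 ≤ 3 * l) :
    j / L' + (3 / 2) / L' ≤ (3 / 2) / (L' / l) := by
  rw [← add_div, div_div_eq_mul_div]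
  gcongr
  linarith

lemma Ln_eq (hl : ∀ m, 5 ≤ l m) (m : ℕ) : (Ln l m : ℝ) = (Ln l (m + 1) : ℝ) / l m := by
  have h5 := hl m
  have : (0:ℝ) < l m := by positivity
  rw [Ln_succ]; push_cast; field_simp

lemma delta_approx (hq : ∀ j k : Fin 3, j ≠ k → dist (q j) (q k) = 1) (hl : ∀ m, 5 ≤ l m)
    (r : ℕ) : ∀ (m : ℕ) (w : ℕ → ℕ × ℕ) (_ : w ∈ Wn l m) (y : E2) (_ : y ∈ Gasket q l)
    (_ : y ∈ TT q l m w), ∃ y', dist y' y ≤ 2 / Ln l (m + r) ∧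
      ∀ c, Reach q l (cor q l m w c) y' ((3 / 2) / Ln l m) := by
  induction r with
  | zero =>
    intro m w hw y hy hyw
    refine ⟨cor q l m w 0, cor_near hq hl m w y hyw 0, fun c =>
      (reach_edge hq hl m w hw c 0).mono ?_⟩
    have := Ln_pos l hl m
    gcongr; norm_num
  | succ r ih =>
    intro m w hw y hy hyw
    have h5 := hl m
    have h5' : (5:ℝ) ≤ l m := by exact_mod_cast h5
    have hL' := Ln_pos l hl (m + 1)
    obtain ⟨j, hj, hyj⟩ := exists_rc hq hl w m hw y hy hyw 0
    obtain ⟨y', hd, H⟩ := ih (m + 1) _ (rc_mem hl w m (0 + j) hw) y hy hyj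
    refine ⟨y', ?_, fun c => ?_⟩
    · rwa [show m + (r + 1) = m + 1 + r by omega]
    -- relative position to corner c
    have hN : 0 < 3 * l m - 3 := by omega
    obtain ⟨i, hi, hji⟩ : ∃ i < 3 * l m - 3,
        rc l w m (0 + j) = rc l w m (c.val * (l m - 1) + i) := by
      have hc : c.val * (l m - 1) < 3 * l m - 3 := by
        fin_cases c <;> simp <;> omega
      by_cases h : c.val * (l m - 1) ≤ j
      · exact ⟨j - c.val * (l m - 1), by omega, by congr 1; omega⟩
      · refine ⟨j + (3 * l m - 3) - c.val * (l m - 1), by omega, ?_⟩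
        rw [show c.val * (l m - 1) + (j + (3 * l m - 3) - c.val * (l m - 1)) = 0 + j + (3 * l m - 3)
          by omega, rc_add_N]
    rw [hji] at H
    rw [Ln_eq hl m]
    by_cases h : 2 * i ≤ 3 * l m - 3
    · refine (step_fwd hq hl w m hw c _ (rc_cc hl w m c) i y' _ H).mono
        (delta_ineq _ _ 0 _ hL' (by linarith) ?_)
      have : 2 * i + 3 ≤ 3 * l m := by omega
      exact_mod_cast this
    · refine (step_bwd hq hl w m hw c _ (3 * l m - 3 - i) ?_ y' _ H).mono
        (delta_ineq _ _ 0 _ hL' (by linarith) ?_)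
      · rw [add_assoc, show i + (3 * l m - 3 - i) = 3 * l m - 3 by omega, rc_add_N, rc_cc hl]
      · have : 2 * (3 * l m - 3 - i) + 3 ≤ 3 * l m := by omega
        exact_mod_cast this

lemma delta_weak (hq : ∀ j k : Fin 3, j ≠ k → dist (q j) (q k) = 1) (hl : ∀ m, 5 ≤ l m)
    (m : ℕ) (w : ℕ → ℕ × ℕ) (hw : w ∈ Wn l m) (y : E2) (hy : y ∈ Gasket q l)
    (hyw : y ∈ TT q l m w) (c : Fin 3) :
    Reach q l (cor q l m w c) y ((3 / 2) / Ln l m) := by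
  apply Reach.limit hl
  intro ε hε
  obtain ⟨r, hr⟩ := approx_eps hl m ε hε
  obtain ⟨y', h1, h2⟩ := delta_approx hq hl r m w hw y hy hyw
  exact ⟨y', lt_of_le_of_lt h1 hr, h2 c⟩

lemma rc_shift (hl : ∀ m, 5 ≤ l m) (w : ℕ → ℕ × ℕ) (m : ℕ) (a b : Fin 3) (hab : b = a + 1) :
    rc l w m (a.val * (l m - 1) + (l m - 1)) = ch w m (cc (l m) b) := by
  rw [← rc_cc hl]
  have h5 := hl m
  subst hab
  fin_cases a
  · simp
  · simp; congr 1; omega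
  · have := rc_add_N (l := l) w m 0
    have e : 2 * (l m - 1) + (l m - 1) = 0 + (3 * l m - 3) := by omega
    change rc l w m (2 * (l m - 1) + (l m - 1)) = rc l w m (0 * (l m - 1))
    rw [e, this, zero_mul]

lemma rEnt_ne_rExt (l t : ℕ) (hl : 5 ≤ l) (ht : t < 3 * l - 3) : rEnt l t ≠ rExt l t := by
  unfold rEnt rExt; split_ifs <;> first | decide | omega

lemma sig_ineq (l j L' : ℝ) (hL : 0 < L') (h0 : 0 < l) (h : 2 * j + 3 ≤ 2 * l) :
    j / L' + (3 / 2) / L' ≤ 1 / (L' / l) := by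
  rw [← add_div, div_div_eq_mul_div]
  gcongr
  linarith

lemma sigma_approx (hq : ∀ j k : Fin 3, j ≠ k → dist (q j) (q k) = 1) (hl : ∀ m, 5 ≤ l m)
    (r : ℕ) : ∀ (m : ℕ) (w : ℕ → ℕ × ℕ) (_ : w ∈ Wn l m) (y : E2) (_ : y ∈ Gasket q l)
    (_ : y ∈ TT q l m w) (a b : Fin 3) (_ : a ≠ b), ∃ y', dist y' y ≤ 2 / Ln l (m + r) ∧
      (Reach q l (cor q l m w a) y' (1 / Ln l m) ∨ Reach q l (cor q l m w b) y' (1 / Ln l m)) := by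
  induction r with
  | zero =>
    intro m w hw y hy hyw a b hab
    exact ⟨cor q l m w 0, cor_near hq hl m w y hyw 0, Or.inl (reach_edge hq hl m w hw a 0)⟩
  | succ r ih =>
    intro m w hw y hy hyw
    have main : ∀ a b : Fin 3, b = a + 1 → ∃ y', dist y' y ≤ 2 / Ln l (m + (r + 1)) ∧
      (Reach q l (cor q l m w a) y' (1 / Ln l m) ∨ Reach q l (cor q l m w b) y' (1 / Ln l m)) := by
      intro a b hab
      have h5 := hl m
      have h5' : (5:ℝ) ≤ l m := by exact_mod_cast h5
      have hl0 : (0:ℝ) < l m := by linarith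
      have hL' := Ln_pos l hl (m + 1)
      have hLp := Ln_pos l hl (m + (r + 1))
      obtain ⟨j, hj, hyj⟩ := exists_rc hq hl w m hw y hy hyw (a.val * (l m - 1))
      have ha := rc_cc hl w m a
      have hb := rc_shift hl w m a b hab
      set ta := a.val * (l m - 1) with hta
      have hwj := rc_mem hl w m (ta + j) hw
      have D := delta_weak hq hl (m + 1) _ hwj y hy hyj
      have d0 : dist y y ≤ 2 / (Ln l (m + (r + 1)) : ℝ) := by rw [dist_self]; positivity
      have haN : rc l w m (ta + (3 * l m - 3)) = ch w m (cc (l m) a) := by rw [rc_add_N, ha]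
      rcases lt_trichotomy j (2 * (l m - 1)) with h | h | h
      · by_cases h2 : j < l m - 1
        · refine ⟨y, d0, Or.inl ?_⟩
          rw [Ln_eq hl m]
          refine (step_fwd hq hl w m hw a _ ha j y _ D).mono (sig_ineq _ _ _ hL' hl0 ?_)
          have : 2 * j + 3 ≤ 2 * l m := by omega
          exact_mod_cast this
        · refine ⟨y, d0, Or.inr ?_⟩
          rw [Ln_eq hl m]
          have e : ta + j = ta + (l m - 1) + (j - (l m - 1)) := by omega
          rw [e] at D
          refine (step_fwd hq hl w m hw b _ hb _ y _ D).mono (sig_ineq _ _ _ hL' hl0 ?_)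
          have : 2 * (j - (l m - 1)) + 3 ≤ 2 * l m := by omega
          exact_mod_cast this
      · obtain ⟨y', h1, h2⟩ := ih (m + 1) _ hwj y hy hyj _ _
          (rEnt_ne_rExt (l m) ((ta + j) % (3 * l m - 3)) h5 (Nat.mod_lt _ (by omega)))
        refine ⟨y', by rwa [show m + (r + 1) = m + 1 + r by omega], ?_⟩
        rw [Ln_eq hl m]
        have key : ((l m - 1 : ℕ) : ℝ) / Ln l (m + 1) + 1 / Ln l (m + 1) ≤
            1 / ((Ln l (m + 1) : ℝ) / l m) := by
          rw [Nat.cast_sub (by omega), ← add_div, div_div_eq_mul_div]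
          apply le_of_eq; congr 1; push_cast; ring
        rcases h2 with h2 | h2
        · right
          have R := reach_fwd hq hl w m hw b _ hb (l m - 1) (by omega)
          rw [show ta + (l m - 1) + (l m - 1) = ta + j by omega] at R
          exact (R.trans h2).mono key
        · left
          have R := reach_bwd hq hl w m hw a (ta + j) (l m - 1) (by omega)
            (by rw [show ta + j + (l m - 1) = ta + (3 * l m - 3) by omega, haN])
          exact (R.trans h2).mono key
      · refine ⟨y, d0, Or.inl ?_⟩
        rw [Ln_eq hl m]
        refine (step_bwd hq hl w m hw a _ (3 * l m - 3 - j) ?_ y _ D).mono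
          (sig_ineq _ _ _ hL' hl0 ?_)
        · rw [← haN]; congr 1; omega
        · have : 2 * (3 * l m - 3 - j) + 3 ≤ 2 * l m := by omega
          exact_mod_cast this
    intro a b hab
    have hcase : b = a + 1 ∨ a = b + 1 := by revert a b; decide
    rcases hcase with h | h
    · exact main a b h
    · obtain ⟨y', h1, h2⟩ := main b a h
      exact ⟨y', h1, h2.symm⟩

lemma sigma_weak (hq : ∀ j k : Fin 3, j ≠ k → dist (q j) (q k) = 1) (hl : ∀ m, 5 ≤ l m)
    (m : ℕ) (w : ℕ → ℕ × ℕ) (hw : w ∈ Wn l m) (y : E2) (hy : y ∈ Gasket q l)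
    (hyw : y ∈ TT q l m w) (a b : Fin 3) (hab : a ≠ b) :
    Reach q l (cor q l m w a) y (1 / Ln l m) ∨ Reach q l (cor q l m w b) y (1 / Ln l m) := by
  by_cases h : ∀ ε > 0, ∃ y', dist y' y < ε ∧ Reach q l (cor q l m w a) y' (1 / Ln l m)
  · exact Or.inl (Reach.limit hl h)
  · right
    push Not at h
    obtain ⟨ε0, hε0, h⟩ := h
    apply Reach.limit hl
    intro ε hε
    obtain ⟨r, hr⟩ := approx_eps hl m (min ε ε0) (lt_min hε hε0)
    obtain ⟨y', h1, h2⟩ := sigma_approx hq hl r m w hw y hy hyw a b hab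
    have h3 := lt_of_le_of_lt h1 hr
    rcases h2 with h2 | h2
    · exact absurd h2 (h y' (h3.trans_le (min_le_right _ _)))
    · exact ⟨y', h3.trans_le (min_le_left _ _), h2⟩

lemma delta_strict (hq : ∀ j k : Fin 3, j ≠ k → dist (q j) (q k) = 1) (hl : ∀ m, 5 ≤ l m)
    (m : ℕ) (w : ℕ → ℕ × ℕ) (hw : w ∈ Wn l m) (y : E2) (hy : y ∈ Gasket q l)
    (hyw : y ∈ TT q l m w) (c : Fin 3) :
    ∃ T < (3 / 2) / (Ln l m : ℝ), Reach q l (cor q l m w c) y T := by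
  have h5 := hl m
  have h5' : (5:ℝ) ≤ l m := by exact_mod_cast h5
  have hl0 : (0:ℝ) < l m := by linarith
  have hL' := Ln_pos l hl (m + 1)
  refine ⟨(3 * l m - 1) / 2 / Ln l (m + 1), ?_, ?_⟩
  · rw [Ln_eq hl m, div_div_eq_mul_div]
    gcongr; linarith
  obtain ⟨j, hj, hyj⟩ := exists_rc hq hl w m hw y hy hyw (c.val * (l m - 1))
  have ha := rc_cc hl w m c
  set ta := c.val * (l m - 1) with hta
  have hwj := rc_mem hl w m (ta + j) hw
  have D := delta_weak hq hl (m + 1) _ hwj y hy hyj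
  have haN : rc l w m (ta + j + (3 * l m - 3 - j)) = ch w m (cc (l m) c) := by
    rw [show ta + j + (3 * l m - 3 - j) = ta + (3 * l m - 3) by omega, rc_add_N, ha]
  rcases lt_trichotomy (2 * j) (3 * l m - 3) with h | h | h
  · refine (step_fwd hq hl w m hw c _ ha j y _ D).mono ?_
    rw [← add_div]
    gcongr
    have : 2 * j + 4 ≤ 3 * l m := by omega
    have : 2 * (j:ℝ) + 4 ≤ 3 * l m := by exact_mod_cast this
    linarith
  · have key : (j:ℝ) / Ln l (m + 1) + 1 / Ln l (m + 1) ≤ (3 * l m - 1) / 2 / Ln l (m + 1) := by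
      rw [← add_div]
      gcongr
      have : 2 * j + 3 ≤ 3 * l m := by omega
      have : 2 * (j:ℝ) + 3 ≤ 3 * l m := by exact_mod_cast this
      linarith
    rcases sigma_weak hq hl (m + 1) _ hwj y hy hyj _ _
      (rEnt_ne_rExt (l m) ((ta + j) % (3 * l m - 3)) h5 (Nat.mod_lt _ (by omega))) with h2 | h2
    · exact ((reach_fwd hq hl w m hw c _ ha j (by omega)).trans h2).mono key
    · have R := reach_bwd hq hl w m hw c (ta + j) j (by omega)
        (by rw [show ta + j + j = ta + j + (3 * l m - 3 - j) by omega, haN])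
      exact (R.trans h2).mono key
  · refine (step_bwd hq hl w m hw c _ _ haN y _ D).mono ?_
    rw [← add_div]
    gcongr
    have : 2 * (3 * l m - 3 - j) + 4 ≤ 3 * l m := by omega
    have : 2 * ((3 * l m - 3 - j : ℕ):ℝ) + 4 ≤ 3 * l m := by exact_mod_cast this
    linarith

end

section
variable {q : Fin 3 → E2} {l : ℕ → ℕ}

lemma Mn_pos (hl : ∀ m, 5 ≤ l m) (n : ℕ) : 0 < Mn l n :=
  Finset.prod_pos fun k _ => by have := hl k; omega

lemma zero_mem_W0 : (fun _ => (0, 0) : ℕ → ℕ × ℕ) ∈ Wn l 0 := ⟨fun k hk => by omega, fun _ _ => rfl⟩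

lemma Gasket_subset_cells (hl : ∀ m, 5 ≤ l m) (n : ℕ) :
    Gasket q l ⊆ ⋃ w ∈ WF l n, Cell q l n w := by
  intro y hy
  obtain ⟨w, hw, h⟩ := (mem_Gasket q l y).1 hy n
  simp only [mem_iUnion]
  exact ⟨w, (mem_WF l hl n w).2 hw, hy, h⟩

lemma Gasket_meas {μ : Measure E2} (hμ : IsUnif q l μ) : μ (Gasket q l) = 1 := by
  have h := hμ.2 0 _ (zero_mem_W0 (l := l))
  have e : Cell q l 0 (fun _ => (0, 0)) = Gasket q l := by
    apply Subset.antisymm inter_subset_left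
    intro y hy
    refine ⟨hy, ?_⟩
    obtain ⟨w, hw, h⟩ := (mem_Gasket q l y).1 hy 0
    exact h
  rw [e] at h
  simpa [Mn] using h

lemma cells_le (hl : ∀ m, 5 ≤ l m) {μ : Measure E2} (hμ : IsUnif q l μ) (n : ℕ)
    (J : Finset (ℕ → ℕ × ℕ)) (hJ : ∀ w ∈ J, w ∈ Wn l n) :
    μ (⋃ w ∈ J, Cell q l n w) ≤ (J.card : ℝ≥0∞) * (Mn l n : ℝ≥0∞)⁻¹ := by
  refine (measure_biUnion_finset_le J _).trans ?_
  rw [Finset.sum_congr rfl fun w hw => hμ.2 n w (hJ w hw)]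
  simp

open Classical in
lemma cells_ge (hl : ∀ m, 5 ≤ l m) {μ : Measure E2} (hμ : IsUnif q l μ) (n : ℕ)
    (J : Finset (ℕ → ℕ × ℕ)) (hJ : ∀ w ∈ J, w ∈ Wn l n) :
    (J.card : ℝ≥0∞) * (Mn l n : ℝ≥0∞)⁻¹ ≤ μ (⋃ w ∈ J, Cell q l n w) := by
  have hM := Mn_pos hl n
  have hsub : J ⊆ WF l n := fun w hw => (mem_WF l hl n w).2 (hJ w hw)
  have hc := card_WF l n
  have hJc := Finset.card_le_card hsub
  have h1 : (1 : ℝ≥0∞) ≤ μ (⋃ w ∈ J, Cell q l n w) +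
      ((Mn l n - J.card : ℕ) : ℝ≥0∞) * (Mn l n : ℝ≥0∞)⁻¹ := by
    calc (1 : ℝ≥0∞) = μ (Gasket q l) := (Gasket_meas hμ).symm
      _ ≤ μ ((⋃ w ∈ J, Cell q l n w) ∪ ⋃ w ∈ WF l n \ J, Cell q l n w) := by
          apply measure_mono
          refine (Gasket_subset_cells hl n).trans ?_
          intro y hy
          simp only [mem_iUnion, mem_union] at hy ⊢
          obtain ⟨w, hw, h⟩ := hy
          by_cases hwJ : w ∈ J
          · exact Or.inl ⟨w, hwJ, h⟩
          · exact Or.inr ⟨w, Finset.mem_sdiff.2 ⟨hw, hwJ⟩, h⟩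
      _ ≤ _ := by
          refine (measure_union_le _ _).trans (add_le_add le_rfl ?_)
          refine (cells_le hl hμ n _ fun w hw => (mem_WF l hl n w).1 (Finset.mem_sdiff.1 hw).1).trans ?_
          gcongr
          rw [Finset.card_sdiff_of_subset hsub]; omega
  have h2 : (1 : ℝ≥0∞) = (J.card : ℝ≥0∞) * (Mn l n : ℝ≥0∞)⁻¹ +
      ((Mn l n - J.card : ℕ) : ℝ≥0∞) * (Mn l n : ℝ≥0∞)⁻¹ := by
    rw [← add_mul, ← Nat.cast_add, show J.card + (Mn l n - J.card) = Mn l n by omega]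
    exact (ENNReal.mul_inv_cancel (by simpa using hM.ne') (by simp)).symm
  rw [h2] at h1
  refine (ENNReal.add_le_add_iff_right ?_).1 h1
  exact ENNReal.mul_ne_top (by simp) (by simpa using hM.ne')

lemma ch_inj (w : ℕ → ℕ × ℕ) (m : ℕ) (i j : ℕ × ℕ) (h : ch w m i = ch w m j) : i = j := by
  have := congrFun h m
  simpa [ch] using this

lemma low (hq : ∀ j k : Fin 3, j ≠ k → dist (q j) (q k) = 1) (hl : ∀ m, 5 ≤ l m)
    {μ : Measure E2} (hμ : IsUnif q l μ) (x : E2) (hx : x ∈ Gasket q l) (m r : ℕ) (h3 : 3 ≤ r)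
    (hr : r ≤ l m) (s : ℝ) (hs : (r : ℝ) / Ln l (m + 1) ≤ s) :
    ((2 * r - 3 : ℕ) : ℝ≥0∞) * (Mn l (m + 1) : ℝ≥0∞)⁻¹ ≤ μ (Bd q l x s) := by
  classical
  have h5 := hl m
  have hN : 0 < 3 * l m - 3 := by omega
  have hL' := Ln_pos l hl (m + 1)
  obtain ⟨w, hw, hxw⟩ := (mem_Gasket q l x).1 hx m
  obtain ⟨t, ht, hxt⟩ := exists_rc hq hl w m hw x hx hxw 0
  rw [zero_add] at hxt
  set N := 3 * l m - 3 with hNdef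
  let g : ℕ → (ℕ → ℕ × ℕ) := fun i => rc l w m (t + (N - (r - 2)) + i)
  have hcard : ((Finset.range (2 * r - 3)).image g).card = 2 * r - 3 := by
    rw [Finset.card_image_of_injOn, Finset.card_range]
    intro i hi j hj hij
    simp only [Finset.coe_range, mem_Iio] at hi hj
    have h1 := ringE_inj _ _ _ h5 (Nat.mod_lt _ hN) (Nat.mod_lt _ hN) (ch_inj w m _ _ hij)
    have h2 : i ≡ j [MOD N] := Nat.ModEq.add_left_cancel' _ h1
    exact Nat.ModEq.eq_of_lt_of_lt h2 (by omega) (by omega)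
  have hJ : ∀ v ∈ (Finset.range (2 * r - 3)).image g, v ∈ Wn l (m + 1) := by
    intro v hv
    obtain ⟨i, _, rfl⟩ := Finset.mem_image.1 hv
    exact rc_mem hl w m _ hw
  have key := cells_ge hl hμ (m + 1) _ hJ
  rw [hcard] at key
  refine key.trans (measure_mono ?_)
  intro y hy
  simp only [mem_iUnion] at hy
  obtain ⟨v, hv, hyG, hyv⟩ := hy
  obtain ⟨i, hi, rfl⟩ := Finset.mem_image.1 hv
  rw [Finset.mem_range] at hi
  refine ⟨hyG, ?_⟩
  change y ∈ TT q l (m + 1) (rc l w m (t + (N - (r - 2)) + i)) at hyv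
  have X := delta_strict hq hl (m + 1) _ (rc_mem hl w m t hw) x hx hxt
  have Y := delta_strict hq hl (m + 1) _ (rc_mem hl w m _ hw) y hyG hyv
  have e32 : (3 / 2 : ℝ) / Ln l (m + 1) + (3 / 2) / Ln l (m + 1) = 3 / Ln l (m + 1) := by ring
  rcases lt_trichotomy i (r - 2) with h | h | h
  · obtain ⟨T1, hT1, R1⟩ := X (rEnt (l m) (t % (3 * l m - 3)))
    obtain ⟨T2, hT2, R2⟩ := Y (rExt (l m) ((t + (N - (r - 2)) + i) % (3 * l m - 3)))
    have R := reach_chain hq hl w m hw (t + (N - (r - 2)) + i) (r - 2 - i - 1)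
    have e : ent q l w m (t + (N - (r - 2)) + i + (r - 2 - i - 1 + 1)) = ent q l w m t := by
      rw [show t + (N - (r - 2)) + i + (r - 2 - i - 1 + 1) = t + N by omega]
      simp [ent, rc, N]
    rw [e] at R
    refine ((R2.symm.trans R).trans R1).symm.gdist_lt (lt_of_lt_of_le ?_ hs)
    have : ((r - 2 - i - 1 : ℕ) : ℝ) / Ln l (m + 1) + 3 / Ln l (m + 1) ≤ r / Ln l (m + 1) := by
      rw [← add_div]; gcongr
      have : r - 2 - i - 1 + 3 ≤ r := by omega
      exact_mod_cast this
    linarith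
  · obtain ⟨T1, hT1, R1⟩ := X 0
    obtain ⟨T2, hT2, R2⟩ := Y 0
    have e : rc l w m (t + (N - (r - 2)) + i) = rc l w m t := by
      rw [show t + (N - (r - 2)) + i = t + N by omega, rc_add_N]
    rw [e] at R2
    refine (R1.symm.trans R2).gdist_lt (lt_of_lt_of_le ?_ hs)
    have : (3 : ℝ) / Ln l (m + 1) ≤ r / Ln l (m + 1) := by
      gcongr; exact_mod_cast h3
    linarith
  · obtain ⟨T1, hT1, R1⟩ := X (rExt (l m) (t % (3 * l m - 3)))
    obtain ⟨T2, hT2, R2⟩ := Y (rEnt (l m) ((t + (N - (r - 2)) + i) % (3 * l m - 3)))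
    have R := reach_chain hq hl w m hw t (i - (r - 2) - 1)
    have e : ent q l w m (t + (i - (r - 2) - 1 + 1)) = ent q l w m (t + (N - (r - 2)) + i) := by
      rw [show t + (N - (r - 2)) + i = t + (i - (r - 2) - 1 + 1) + N by omega]
      simp [ent, rc, N]
    rw [e] at R
    refine ((R1.symm.trans R).trans R2).gdist_lt (lt_of_lt_of_le ?_ hs)
    have : ((i - (r - 2) - 1 : ℕ) : ℝ) / Ln l (m + 1) + 3 / Ln l (m + 1) ≤ r / Ln l (m + 1) := by
      rw [← add_div]; gcongr
      have : i - (r - 2) - 1 + 3 ≤ r := by omega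
      exact_mod_cast this
    linarith

lemma ofReal_le_aux (a b : ℕ) (M : ℕ) (hM : 0 < M) (c : ℝ) (h : c ≤ a / M) :
    ENNReal.ofReal c ≤ (a : ℝ≥0∞) * (M : ℝ≥0∞)⁻¹ := by
  refine (ENNReal.ofReal_le_ofReal h).trans (le_of_eq ?_)
  rw [ENNReal.ofReal_div_of_pos (by exact_mod_cast hM), ENNReal.ofReal_natCast, ENNReal.ofReal_natCast,
    div_eq_mul_inv]

/-- one full level: radius `1/L_m` -/
lemma low_full (hq : ∀ j k : Fin 3, j ≠ k → dist (q j) (q k) = 1) (hl : ∀ m, 5 ≤ l m)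
    {μ : Measure E2} (hμ : IsUnif q l μ) (x : E2) (hx : x ∈ Gasket q l) (m : ℕ) (s : ℝ)
    (hs : (1 : ℝ) / Ln l m ≤ s) :
    ENNReal.ofReal (7 / 12 / Mn l m) ≤ μ (Bd q l x s) := by
  have h5 := hl m
  have h5' : (5:ℝ) ≤ l m := by exact_mod_cast h5
  have hM := Mn_pos hl m
  have hM' : (0:ℝ) < Mn l m := by exact_mod_cast hM
  refine le_trans ?_ (low hq hl hμ x hx m (l m) (by omega) le_rfl s ?_)
  · refine ofReal_le_aux _ 0 _ (Mn_pos hl _) _ ?_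
    have e : Mn l (m + 1) = Mn l m * (3 * l m - 3) := Finset.prod_range_succ _ _
    rw [e, Nat.cast_mul, Nat.cast_sub (by omega), Nat.cast_sub (by omega)]
    push_cast
    rw [div_le_div_iff₀ hM' (by apply mul_pos hM'; linarith)]
    nlinarith
  · rw [Ln_eq hl m, div_div_eq_mul_div, one_mul] at hs
    exact hs

lemma low_main (hq : ∀ j k : Fin 3, j ≠ k → dist (q j) (q k) = 1) (hl : ∀ m, 5 ≤ l m)
    {μ : Measure E2} (hμ : IsUnif q l μ) (x : E2) (hx : x ∈ Gasket q l) (m k : ℕ) (h2 : 2 ≤ k)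
    (hk : k ≤ l m) (s : ℝ) (hs : ((k : ℝ) - 1) / Ln l (m + 1) ≤ s) :
    ENNReal.ofReal ((7 / 36) * (k : ℝ) / (Mn l (m + 1) : ℝ)) ≤ μ (Bd q l x s) := by
  have hL' := Ln_pos l hl (m + 1)
  have h2' : (2:ℝ) ≤ k := by exact_mod_cast h2
  by_cases h4 : 4 ≤ k
  · have h4' : (4:ℝ) ≤ k := by exact_mod_cast h4
    refine le_trans ?_ (low hq hl hμ x hx m (k - 1) (by omega) (by omega) s ?_)
    · refine ofReal_le_aux _ 0 _ (Mn_pos hl _) _ ?_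
      gcongr
      rw [show 2 * (k - 1) - 3 = 2 * k - 5 by omega, Nat.cast_sub (by omega)]
      push_cast
      linarith
    · rw [Nat.cast_sub (by omega)]; simpa using hs
  · have h4' : (k:ℝ) ≤ 3 := by exact_mod_cast (by omega : k ≤ 3)
    refine le_trans ?_ (low_full hq hl hμ x hx (m + 1) s (le_trans ?_ hs))
    · apply ENNReal.ofReal_le_ofReal
      gcongr
      linarith
    · gcongr; linarith

end

section
variable {q : Fin 3 → E2} {l : ℕ → ℕ}

lemma Tn_pos (hl : ∀ m, 5 ≤ l m) (n : ℕ) : 0 < Tn l n := by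
  have hM := Mn_pos hl n
  have hR : 0 < Rn l n := Finset.prod_pos fun k _ => by unfold rl; positivity
  have : (0:ℝ) < Mn l n := by exact_mod_cast hM
  unfold Tn; positivity

lemma psi_small (hl : ∀ m, 5 ≤ l m) (Psi : ℝ → ℝ) (hPsi : IsPsi l Psi) (m k : ℕ) (h2 : 2 ≤ k)
    (hk : k ≤ l m) (s : ℝ) (hs : ((k : ℝ) - 1) / Ln l (m + 1) ≤ s) (hs' : s ≤ (k : ℝ) / Ln l (m + 1)) :
    (1 / 18) * (k : ℝ) ^ 2 / Tn l (m + 1) ≤ Psi s ∧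
       Psi s ≤ (9 / 2) * (k : ℝ) ^ 2 / Tn l (m + 1) := by
  have hL := Ln_pos l hl (m + 1)
  have hT := Tn_pos hl (m + 1)
  have h5' : (5:ℝ) ≤ l m := by exact_mod_cast hl m
  have h2' : (2:ℝ) ≤ k := by exact_mod_cast h2
  have hk' : (k:ℝ) ≤ l m := by exact_mod_cast hk
  have e : Psi s = psiPiece l m s := by
    apply hPsi.1
    · rw [inv_eq_one_div]; refine le_trans ?_ hs
      gcongr; linarith
    · rw [inv_eq_one_div, Ln_eq hl m, div_div_eq_mul_div, one_mul]; refine hs'.trans ?_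
      gcongr
  rw [div_le_iff₀ hL] at hs
  rw [le_div_iff₀ hL] at hs'
  rw [e, psiPiece]
  set z := (Ln l (m + 1) : ℝ) * s - 1 with hz
  set A := (3 * (l m : ℝ) - 4) / ((l m : ℝ) - 1) with hA
  set B := ((2 / 3) * (l m : ℝ) - 8 / 9) / ((l m : ℝ) - 1) with hB
  have hA1 : 1 ≤ A := by rw [hA, le_div_iff₀ (by linarith)]; linarith
  have hA2 : A ≤ 3 := by rw [hA, div_le_iff₀ (by linarith)]; linarith
  have hB1 : 1 / 2 ≤ B := by rw [hB, le_div_iff₀ (by linarith)]; linarith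
  have hB2 : B ≤ 2 / 3 := by rw [hB, div_le_iff₀ (by linarith)]; linarith
  have hz1 : (k:ℝ) - 2 ≤ z := by rw [hz]; linarith
  have hz2 : z ≤ (k:ℝ) - 1 := by rw [hz]; linarith
  have hz0 : 0 ≤ z := by linarith
  have a1 : (k:ℝ) - 1 ≤ 1 + A * z := by nlinarith
  have a2 : 1 + A * z ≤ 3 * k - 2 := by nlinarith
  have b1 : (k:ℝ) / 2 ≤ 1 + B * z := by nlinarith
  have b2 : 1 + B * z ≤ (2 * k + 1) / 3 := by nlinarith
  have u := mul_le_mul a1 b1 (by linarith) (by linarith)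
  have v := mul_le_mul a2 b2 (by linarith) (by linarith)
  constructor
  · rw [mul_assoc, div_eq_inv_mul]
    refine mul_le_mul_of_nonneg_left ?_ (by positivity)
    refine le_trans ?_ u
    nlinarith
  · rw [mul_assoc, div_eq_inv_mul]
    refine mul_le_mul_of_nonneg_left ?_ (by positivity)
    refine v.trans ?_
    nlinarith

lemma beta_bd (l : ℕ) (hl : 5 ≤ l) :
    0 ≤ Real.logb l (2 * (l : ℝ) ^ 2 - (5 / 3) * (l : ℝ) - 1 / 3) ∧
    Real.logb l (2 * (l : ℝ) ^ 2 - (5 / 3) * (l : ℝ) - 1 / 3) ≤ 12 / 5 := by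
  have h5' : (5:ℝ) ≤ l := by exact_mod_cast hl
  have hX : 1 ≤ 2 * (l : ℝ) ^ 2 - (5 / 3) * (l : ℝ) - 1 / 3 := by nlinarith
  constructor
  · exact Real.logb_nonneg (by linarith) hX
  rw [Real.logb_le_iff_le_rpow (by linarith) (by linarith)]
  have key : (2 * (l : ℝ) ^ 2 - (5 / 3) * (l : ℝ) - 1 / 3) ^ 5 ≤ (l : ℝ) ^ 12 := by
    rcases Nat.eq_or_lt_of_le hl with h | h
    · rw [← h]; norm_num
    · have h6 : (6:ℝ) ≤ l := by exact_mod_cast h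
      have : (2 * (l : ℝ) ^ 2 - (5 / 3) * (l : ℝ) - 1 / 3) ^ 5 ≤ (2 * (l:ℝ) ^ 2) ^ 5 := by
        gcongr; linarith
      refine this.trans ?_
      have : (2 * (l:ℝ) ^ 2) ^ 5 = 32 * (l:ℝ) ^ 10 := by ring
      rw [this, show (l:ℝ) ^ 12 = (l:ℝ) ^ 2 * (l:ℝ) ^ 10 by ring]
      gcongr
      nlinarith
  have : ((l:ℝ) ^ (12 / 5 : ℝ)) ^ 5 = (l:ℝ) ^ 12 := by
    rw [← Real.rpow_natCast, ← Real.rpow_mul (by linarith), ← Real.rpow_natCast]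
    norm_num
  rw [← this] at key
  exact le_of_pow_le_pow_left₀ (by norm_num) (by positivity) key

lemma psi_big (hl : ∀ m, 5 ≤ l m) (Psi : ℝ → ℝ) (hPsi : IsPsi l Psi) (s : ℝ) (h1 : 1 ≤ s) (h3 : s ≤ 3) :
    1 ≤ Psi s ∧ Psi s ≤ 14 := by
  rw [hPsi.2.1 s h1]
  have b0 : 0 ≤ betaZero l := Real.iInf_nonneg fun n => (beta_bd (l n) (hl n)).1
  have b1 : betaZero l ≤ 12 / 5 := by
    refine (ciInf_le ⟨0, ?_⟩ 0).trans (beta_bd (l 0) (hl 0)).2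
    rintro _ ⟨n, rfl⟩
    exact (beta_bd (l n) (hl n)).1
  refine ⟨Real.one_le_rpow h1 b0, ?_⟩
  calc s ^ betaZero l ≤ 3 ^ betaZero l := Real.rpow_le_rpow (by linarith) h3 b0
    _ ≤ 3 ^ (12 / 5 : ℝ) := Real.rpow_le_rpow_of_exponent_le (by norm_num) b1
    _ ≤ 14 := by
      have : ((3:ℝ) ^ (12 / 5 : ℝ)) ^ 5 = 3 ^ 12 := by
        rw [← Real.rpow_natCast, ← Real.rpow_mul (by norm_num), ← Real.rpow_natCast]
        norm_num
      refine le_of_pow_le_pow_left₀ (n := 5) (by norm_num) (by norm_num) ?_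
      rw [this]; norm_num

end

section
variable {q : Fin 3 → E2} {l : ℕ → ℕ}

lemma chain_path (hq : ∀ j k : Fin 3, j ≠ k → dist (q j) (q k) = 1) (hl : ∀ m, 5 ≤ l m) (n : ℕ)
    (G : (ℕ → ℕ × ℕ) → ℤ)
    (hG : ∀ w ∈ Wn l n, ∀ w' ∈ Wn l n, ∀ y, y ∈ TT q l n w → y ∈ TT q l n w' → G w' ≤ G w + 1)
    (γ : ℝ → E2) (N : ℕ) : ∀ (S : Finset (ℕ → ℕ × ℕ)) (_ : S.card ≤ N) (_ : ∀ w ∈ S, w ∈ Wn l n)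
    (a b : ℝ) (_ : a ≤ b) (_ : ContinuousOn γ (Icc a b)) (_ : eVariationOn γ (Icc a b) ≠ ⊤)
    (_ : ∀ t ∈ Ioc a b, ∃ w ∈ S, γ t ∈ TT q l n w) (w : ℕ → ℕ × ℕ) (_ : w ∈ S)
    (_ : γ a ∈ TT q l n w),
    ∃ w' ∈ Wn l n, γ b ∈ TT q l n w' ∧
      (G w' : ℝ) ≤ G w + 1 + Ln l n * (eVariationOn γ (Icc a b)).toReal ∧
      (((∃ j, γ a = cor q l n w j) ∧ (∀ t ∈ Ioc a b, γ t ≠ γ a) ∧ ∃ t ∈ Ioc a b, γ t ∈ TT q l n w) →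
        (G w' : ℝ) ≤ G w + Ln l n * (eVariationOn γ (Icc a b)).toReal) := by
  classical
  have hL := Ln_pos l hl n
  induction N with
  | zero =>
    intro S hS _ a b _ _ _ _ w hw
    rw [Nat.le_zero, Finset.card_eq_zero] at hS
    simp [hS] at hw
  | succ N ih =>
    intro S hS hSW a b hab hc hV hcov w hw hwa
    have hV0 : 0 ≤ (Ln l n : ℝ) * (eVariationOn γ (Icc a b)).toReal := by positivity
    have hcl : IsClosed (Icc a b ∩ γ ⁻¹' TT q l n w) :=
      hc.preimage_isClosed_of_isClosed isClosed_Icc (isCompact_TT q l n w).isClosed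
    have hcomp : IsCompact (Icc a b ∩ γ ⁻¹' TT q l n w) :=
      isCompact_Icc.of_isClosed_subset hcl inter_subset_left
    obtain ⟨τ, ⟨hτ, hτw⟩, hmax⟩ := hcomp.exists_isGreatest ⟨a, ⟨left_mem_Icc.2 hab, hwa⟩⟩
    have hafter : ∀ t ∈ Ioc τ b, γ t ∉ TT q l n w := by
      intro t ht h
      have := hmax ⟨⟨hτ.1.trans ht.1.le, ht.2⟩, h⟩
      exact absurd ht.1 (not_lt.2 this)
    rcases eq_or_lt_of_le hτ.2 with hb | hb
    · subst hb
      refine ⟨w, hSW w hw, hτw, by linarith, fun _ => by linarith⟩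
    have hsubs : Ioc τ b ⊆ Ioc a b := fun t ht => ⟨lt_of_le_of_lt hτ.1 ht.1, ht.2⟩
    -- the next cell
    obtain ⟨w1, hw1, hne, hw1t, t1, ht1, hw1v⟩ : ∃ w1 ∈ S, w1 ≠ w ∧ γ τ ∈ TT q l n w1 ∧
        ∃ t ∈ Ioc τ b, γ t ∈ TT q l n w1 := by
      let S1 := (S.erase w).filter fun w1 => ∃ t ∈ Ioc τ b, γ t ∈ TT q l n w1
      have hC : IsClosed (⋃ w1 ∈ S1, TT q l n w1) :=
        S1.finite_toSet.isClosed_biUnion fun w1 _ => (isCompact_TT q l n w1).isClosed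
      have hmap : MapsTo γ (Ioc τ b) (⋃ w1 ∈ S1, TT q l n w1) := by
        intro t ht
        obtain ⟨w1, h1, h2⟩ := hcov t (hsubs ht)
        simp only [mem_iUnion]
        refine ⟨w1, Finset.mem_filter.2 ⟨Finset.mem_erase.2 ⟨?_, h1⟩, t, ht, h2⟩, h2⟩
        rintro rfl
        exact hafter t ht h2
      have hcw : ContinuousWithinAt γ (Ioc τ b) τ :=
        (hc τ hτ).mono (hsubs.trans Ioc_subset_Icc_self)
      have hmem : τ ∈ closure (Ioc τ b) := by
        rw [closure_Ioc hb.ne]; exact left_mem_Icc.2 hb.le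
      have := hcw.mem_closure hmem hmap
      rw [hC.closure_eq] at this
      simp only [mem_iUnion] at this
      obtain ⟨w1, h1, h2⟩ := this
      obtain ⟨h3, h4⟩ := Finset.mem_filter.1 h1
      exact ⟨w1, (Finset.mem_erase.1 h3).2, (Finset.mem_erase.1 h3).1, h2, h4⟩
    have hpos : ¬ (px l w n = px l w1 n ∧ py l w n = py l w1 n) := by
      rintro ⟨h1, h2⟩
      exact hne (pos_inj' l hl n w w1 (hSW w hw) (hSW w1 hw1) h1 h2).symm
    obtain ⟨j, j', _, _, hj, hj'⟩ := overlap q hq l hl n w w1 (γ τ) hτw hw1t hpos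
    have hsplit : eVariationOn γ (Icc a τ) + eVariationOn γ (Icc τ b) = eVariationOn γ (Icc a b) := by
      have := eVariationOn.Icc_add_Icc γ (s := univ) hτ.1 hτ.2 (mem_univ _)
      simpa using this
    have hVa : eVariationOn γ (Icc a τ) ≠ ⊤ := fun h => hV (by rw [← hsplit, h, top_add])
    have hVb : eVariationOn γ (Icc τ b) ≠ ⊤ := fun h => hV (by rw [← hsplit, h, add_top])
    have hr : (eVariationOn γ (Icc a b)).toReal =
        (eVariationOn γ (Icc a τ)).toReal + (eVariationOn γ (Icc τ b)).toReal := by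
      rw [← hsplit, ENNReal.toReal_add hVa hVb]
    obtain ⟨w', hw', hbw', _, h2⟩ := ih (S.erase w)
      (by rw [Finset.card_erase_of_mem hw]; omega) (fun v hv => hSW v (Finset.mem_erase.1 hv).2)
      τ b hb.le (hc.mono (Icc_subset_Icc_left hτ.1)) hVb
      (fun t ht => by
        obtain ⟨v, h1, h2⟩ := hcov t (hsubs ht)
        refine ⟨v, Finset.mem_erase.2 ⟨?_, h1⟩, h2⟩
        rintro rfl
        exact hafter t ht h2) w1 (Finset.mem_erase.2 ⟨hne, hw1⟩) hw1t
    have h3 := h2 ⟨⟨j', hj'⟩, fun t ht h => hafter t ht (h ▸ hτw), t1, ht1, hw1v⟩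
    have h4 : (G w1 : ℝ) ≤ G w + 1 := by
      exact_mod_cast hG w (hSW w hw) w1 (hSW w1 hw1) (γ τ) hτw hw1t
    have hVa0 : 0 ≤ (Ln l n : ℝ) * (eVariationOn γ (Icc a τ)).toReal := by positivity
    refine ⟨w', hw', hbw', ?_, ?_⟩
    · rw [hr, mul_add]; linarith
    · rintro ⟨⟨i, hi⟩, hav, t, ht, htw⟩
      have hτt : t ≤ τ := hmax ⟨Ioc_subset_Icc_self ht, htw⟩
      have haτ : a < τ := lt_of_lt_of_le ht.1 hτt
      have hneq := hav τ ⟨haτ, hτ.2⟩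
      have hij : i ≠ j := by
        rintro rfl
        exact hneq (hj.trans hi.symm)
      have hd := cor_dist hq hl n w i j hij
      rw [← hi, ← hj] at hd
      have he := eVariationOn.edist_le γ (s := Icc a τ) (left_mem_Icc.2 hτ.1) (right_mem_Icc.2 hτ.1)
      have : 1 / (Ln l n : ℝ) ≤ (eVariationOn γ (Icc a τ)).toReal := by
        rw [← hd, dist_edist]
        exact ENNReal.toReal_mono hVa he
      rw [div_le_iff₀ hL] at this
      rw [hr, mul_add]; linarith

lemma ball_cell (hq : ∀ j k : Fin 3, j ≠ k → dist (q j) (q k) = 1) (hl : ∀ m, 5 ≤ l m) (n : ℕ)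
    (G : (ℕ → ℕ × ℕ) → ℤ)
    (hG : ∀ w ∈ Wn l n, ∀ w' ∈ Wn l n, ∀ y, y ∈ TT q l n w → y ∈ TT q l n w' → G w' ≤ G w + 1)
    (x : E2) (hx : x ∈ Gasket q l) (w : ℕ → ℕ × ℕ) (hw : w ∈ Wn l n) (hxw : x ∈ TT q l n w)
    (h0 : G w = 0) (k : ℕ) (s : ℝ) (hs : s ≤ k / Ln l n) (y : E2) (hy : y ∈ Bd q l x s) :
    ∃ w' ∈ Wn l n, y ∈ Cell q l n w' ∧ G w' ≤ k := by
  have hL := Ln_pos l hl n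
  obtain ⟨hyK, hys⟩ := hy
  have hfin : pdist q l x y ≠ ⊤ := by
    obtain ⟨v, hv, hxv⟩ := (mem_Gasket q l x).1 hx 0
    obtain ⟨v', hv', hyv⟩ := (mem_Gasket q l y).1 hyK 0
    have h1 := delta_weak hq hl 0 v hv x hx hxv 0
    have h2 := delta_weak hq hl 0 v hv y hyK hyv 0
    exact ne_top_of_le_ne_top (by simp) (h1.symm.trans h2).pdist_le
  have hlt : pdist q l x y < ENNReal.ofReal s := by
    rw [gdist] at hys
    exact (ENNReal.lt_ofReal_iff_toReal_lt hfin).2 hys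
  unfold pdist at hlt
  simp only [iInf_lt_iff] at hlt
  obtain ⟨γ, hc, hm, e0, e1, hv⟩ := hlt
  have hVt : eVariationOn γ (Icc 0 1) ≠ ⊤ := ne_top_of_lt hv
  obtain ⟨w', hw', h1, h2, _⟩ := chain_path hq hl n G hG γ _ (WF l n) le_rfl
    (fun v hv => (mem_WF l hl n v).1 hv) 0 1 zero_le_one hc hVt
    (fun t ht => by
      obtain ⟨v, h1, h2⟩ := (mem_Gasket q l _).1 (hm (Ioc_subset_Icc_self ht)) n
      exact ⟨v, (mem_WF l hl n v).2 h1, h2⟩) w ((mem_WF l hl n w).2 hw) (by rw [e0]; exact hxw)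
  rw [e1] at h1
  refine ⟨w', hw', ⟨hyK, h1⟩, ?_⟩
  have h3 := (ENNReal.lt_ofReal_iff_toReal_lt hVt).1 hv
  have h4 := lt_of_lt_of_le h3 hs
  rw [lt_div_iff₀ hL] at h4
  rw [h0] at h2
  have h5 : (G w' : ℝ) < k + 1 := by push_cast at h2; linarith
  have h6 : G w' < k + 1 := by exact_mod_cast h5
  omega

end

section
variable {q : Fin 3 → E2} {l : ℕ → ℕ}

/-- barycentric coordinates of a cell index -/
def be (l : ℕ) (e : ℕ × ℕ) (j : Fin 3) : ℤ :=
  if j = 0 then (l : ℤ) - 1 - e.1 - e.2 else if j = 1 then (e.1 : ℤ) else (e.2 : ℤ)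

lemma be0 (l : ℕ) (e : ℕ × ℕ) : be l e 0 = (l : ℤ) - 1 - e.1 - e.2 := by simp [be]
lemma be1 (l : ℕ) (e : ℕ × ℕ) : be l e 1 = (e.1 : ℤ) := by simp [be]
lemma be2 (l : ℕ) (e : ℕ × ℕ) : be l e 2 = (e.2 : ℤ) := by simp [be]

lemma be_nonneg (l : ℕ) (hl : 5 ≤ l) (e : ℕ × ℕ) (he : e ∈ Sset l) (j : Fin 3) : 0 ≤ be l e j := by
  have h1 := he.1
  fin_cases j <;> simp [be] <;> omega

lemma be_zero (l : ℕ) (hl : 5 ≤ l) (e : ℕ × ℕ) (he : e ∈ Sset l) : ∃ j, be l e j = 0 := by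
  obtain ⟨h1, h2⟩ := he
  simp only [Nat.mul_eq_zero] at h2
  rcases h2 with (h | h) | h
  · exact ⟨1, by simp [be, h]⟩
  · exact ⟨2, by simp [be, h]⟩
  · exact ⟨0, by simp [be]; omega⟩

def HD (x y k : ℤ) : Prop := (-k ≤ x ∧ x ≤ k) ∧ (-k ≤ y ∧ y ≤ k) ∧ (-k ≤ x + y ∧ x + y ≤ k)

def hd (x y : ℤ) : ℤ := max |x| (max |y| |x + y|)

lemma hd_le (x y k : ℤ) : hd x y ≤ k ↔ HD x y k := by
  simp only [hd, HD, max_le_iff, abs_le]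

def hv (x y : ℤ) : ℤ :=
  min (hd (x + ex 0) (y + ey 0)) (min (hd (x + ex 1) (y + ey 1)) (hd (x + ex 2) (y + ey 2)))

lemma hv_le (x y k : ℤ) : hv x y ≤ k ↔ ∃ i, HD (x + ex i) (y + ey i) k := by
  simp only [hv, min_le_iff, hd_le, Fin.exists_fin_succ, Fin.exists_fin_zero_pi]
  simp [Fin.exists_fin_succ]

lemma HD_add (a b : Fin 3) (x y k x' y' : ℤ) (h : HD x y k) (hx : x' = x + (ex a - ex b))
    (hy : y' = y + (ey a - ey b)) : HD x' y' (k + 1) := by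
  subst hx hy
  unfold HD at *
  fin_cases a <;> fin_cases b <;> simp [ex, ey] <;> omega

/-- graph potential relative to the cell `c` -/
def Gf (l : ℕ) (c : ℕ × ℕ) (X Y : ℤ) (e : ℕ × ℕ) : ℤ :=
  if X = 0 ∧ Y = 0 then hd (e.1 - c.1) (e.2 - c.2) else
    min (l - be l c 0 + hv (l * X + e.1 - l * ex 0) (l * Y + e.2 - l * ey 0))
    (min (l - be l c 1 + hv (l * X + e.1 - l * ex 1) (l * Y + e.2 - l * ey 1))
      (l - be l c 2 + hv (l * X + e.1 - l * ex 2) (l * Y + e.2 - l * ey 2)))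

lemma Gf_in (l : ℕ) (c : ℕ × ℕ) (e : ℕ × ℕ) (k : ℤ) :
    Gf l c 0 0 e ≤ k ↔ HD (e.1 - c.1) (e.2 - c.2) k := by
  simp [Gf, hd_le]

lemma Gf_out (l : ℕ) (c : ℕ × ℕ) (X Y : ℤ) (e : ℕ × ℕ) (k : ℤ) (h : ¬ (X = 0 ∧ Y = 0)) :
    Gf l c X Y e ≤ k ↔ ∃ j i, HD (l * X + e.1 - l * ex j + ex i) (l * Y + e.2 - l * ey j + ey i)
      (k - l + be l c j) := by
  have key : ∀ j x y, (l : ℤ) - be l c j + hv x y ≤ k ↔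
      ∃ i, HD (x + ex i) (y + ey i) (k - l + be l c j) := by
    intro j x y
    rw [← hv_le]
    constructor <;> intro h <;> linarith
  rw [Gf, if_neg h, min_le_iff, min_le_iff, key, key, key]
  constructor
  · rintro (h | h | h)
    exacts [⟨0, h⟩, ⟨1, h⟩, ⟨2, h⟩]
  · rintro ⟨j, h⟩
    fin_cases j
    exacts [Or.inl h, Or.inr (Or.inl h), Or.inr (Or.inr h)]

lemma corner_claim (l X Y p1 p2 : ℤ) (hl : 5 ≤ l) (h1 : 0 ≤ p1) (h2 : 0 ≤ p2) (h3 : p1 + p2 ≤ l)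
    (g1 : l * X ≤ p1) (g2 : l * Y ≤ p2) (g3 : p1 + p2 ≤ l * X + l * Y + l) (hne : ¬ (X = 0 ∧ Y = 0)) :
    ∃ j : Fin 3, p1 = l * ex j ∧ p2 = l * ey j := by
  have a1 : X ≤ 1 := by nlinarith
  have a2 : Y ≤ 1 := by nlinarith
  have a3 : -1 ≤ X := by nlinarith
  have a4 : -1 ≤ Y := by nlinarith
  interval_cases X <;> interval_cases Y <;> simp at hne g1 g2 g3 <;>
    first
    | exact ⟨0, by simp [ex]; omega, by simp [ey]; omega⟩
    | exact ⟨1, by simp [ex]; omega, by simp [ey]; omega⟩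
    | exact ⟨2, by simp [ex]; omega, by simp [ey]; omega⟩
    | (exfalso; omega)

lemma e_lattice (l : ℕ) (hl : 5 ≤ l) (e : ℕ × ℕ) (he : e ∈ Sset l) : (e.1 : ℤ) + e.2 ≤ l - 1 := by
  have := he.1; omega

lemma ex_bd (i : Fin 3) : 0 ≤ ex i ∧ 0 ≤ ey i ∧ ex i + ey i ≤ 1 := by
  fin_cases i <;> simp [ex, ey]

lemma Gf_step (l : ℕ) (hl : 5 ≤ l) (c e e' : ℕ × ℕ) (hc : c ∈ Sset l) (he : e ∈ Sset l)
    (he' : e' ∈ Sset l) (X Y X' Y' : ℤ) (a b : Fin 3)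
    (hx : l * X + e.1 + ex a = l * X' + e'.1 + ex b) (hy : l * Y + e.2 + ey a = l * Y' + e'.2 + ey b) :
    Gf l c X' Y' e' ≤ Gf l c X Y e + 1 := by
  have bc := e_lattice l hl c hc
  have b1 := e_lattice l hl e he
  have b2 := e_lattice l hl e' he'
  obtain ⟨xa1, xa2, xa3⟩ := ex_bd a
  obtain ⟨xb1, xb2, xb3⟩ := ex_bd b
  by_cases h : X = 0 ∧ Y = 0 <;> by_cases h' : X' = 0 ∧ Y' = 0
  · obtain ⟨rfl, rfl⟩ := h
    obtain ⟨rfl, rfl⟩ := h'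
    rw [Gf_in]
    exact HD_add a b _ _ _ _ _ ((Gf_in l c e _).1 le_rfl) (by linarith) (by linarith)
  · obtain ⟨rfl, rfl⟩ := h
    have H := (Gf_in l c e _).1 (le_refl _)
    set k := Gf l c 0 0 e
    obtain ⟨j, hj1, hj2⟩ := corner_claim l X' Y' (e.1 + ex a) (e.2 + ey a) (by omega) (by omega)
      (by omega) (by omega) (by linarith) (by linarith) (by linarith) h'
    rw [Gf_out _ _ _ _ _ _ h']
    refine ⟨j, b, ?_⟩
    have z1 : (l:ℤ) * X' + e'.1 - l * ex j + ex b = 0 := by linarith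
    have z2 : (l:ℤ) * Y' + e'.2 - l * ey j + ey b = 0 := by linarith
    rw [z1, z2]
    unfold HD at H ⊢
    clear z1 z2 hx hy
    fin_cases j <;> simp [ex, ey, be] at hj1 hj2 ⊢ <;> fin_cases a <;> simp [ex, ey] at hj1 hj2 <;> omega
  · obtain ⟨rfl, rfl⟩ := h'
    have H := (Gf_out l c X Y e _ h).1 (le_refl _)
    set k := Gf l c X Y e
    obtain ⟨j2, i, H⟩ := H
    obtain ⟨j, hj1, hj2⟩ := corner_claim l X Y (e'.1 + ex b) (e'.2 + ey b) (by omega) (by omega)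
      (by omega) (by omega) (by linarith) (by linarith) (by linarith) h
    have H2 := HD_add a i _ _ _ (l * ex j - l * ex j2) (l * ey j - l * ey j2) H (by linarith) (by linarith)
    have H0 : 0 ≤ k - l + be l c j2 := by have := H.1; omega
    rw [Gf_in]
    clear H hx hy
    unfold HD at H2 ⊢
    fin_cases j <;> fin_cases j2 <;> simp [ex, ey, be] at hj1 hj2 H2 H0 ⊢ <;> fin_cases b <;>
      simp [ex, ey] at hj1 hj2 <;> omega
  · rw [Gf_out _ _ _ _ _ _ h']
    obtain ⟨j, i, H⟩ := (Gf_out l c X Y e _ h).1 (le_refl _)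
    refine ⟨j, b, ?_⟩
    have := HD_add a i _ _ _ (l * X' + e'.1 - l * ex j + ex b) (l * Y' + e'.2 - l * ey j + ey b) H
      (by linarith) (by linarith)
    convert this using 1
    ring

lemma no_three (hl : ∀ m, 5 ≤ l m) (m : ℕ) : ∀ w0 w1 w2 : ℕ → ℕ × ℕ,
    (∀ k < m, w0 k ∈ Sset (l k)) → (∀ k < m, w1 k ∈ Sset (l k)) → (∀ k < m, w2 k ∈ Sset (l k)) →
    px l w1 m = px l w0 m - 1 → py l w1 m = py l w0 m → px l w2 m = px l w0 m →
    py l w2 m = py l w0 m - 1 → False := by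
  induction m with
  | zero => intro w0 w1 w2 _ _ _ h; simp [px] at h
  | succ m ih =>
    intro w0 w1 w2 h0 h1 h2 e1 e2 e3 e4
    have IH := ih w0 w1 w2 (fun k hk => h0 k (by omega)) (fun k hk => h1 k (by omega))
      (fun k hk => h2 k (by omega))
    have s0 := h0 m (by omega)
    have s1 := h1 m (by omega)
    have s2 := h2 m (by omega)
    simp only [px, py] at e1 e2 e3 e4
    have h5 := hl m
    generalize px l w0 m = X0 at *
    generalize px l w1 m = X1 at *
    generalize px l w2 m = X2 at *
    generalize py l w0 m = Y0 at *
    generalize py l w1 m = Y1 at *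
    generalize py l w2 m = Y2 at *
    have c0 := e_lattice _ h5 _ s0
    have c1 := e_lattice _ h5 _ s1
    have c2 := e_lattice _ h5 _ s2
    obtain ⟨j0, z0⟩ := be_zero _ h5 _ s0
    obtain ⟨j1, z1⟩ := be_zero _ h5 _ s1
    obtain ⟨j2, z2⟩ := be_zero _ h5 _ s2
    clear s0 s1 s2 h0 h1 h2 ih
    generalize w0 m = p0 at *
    generalize w1 m = p1 at *
    generalize w2 m = p2 at *
    obtain ⟨a0, b0⟩ := p0
    obtain ⟨a1, b1⟩ := p1
    obtain ⟨a2, b2⟩ := p2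
    simp only at *
    have hL : (5:ℤ) ≤ l m := by exact_mod_cast h5
    generalize hLl : (l m : ℤ) = L at *
    have f1 : X2 = X0 := by
      have u1 : X2 < X0 + 1 := by nlinarith
      have u2 : X0 < X2 + 1 := by nlinarith
      omega
    have f2 : Y1 = Y0 := by
      have u1 : Y1 < Y0 + 1 := by nlinarith
      have u2 : Y0 < Y1 + 1 := by nlinarith
      omega
    have f3 : X1 = X0 ∨ X1 = X0 - 1 := by
      have u1 : X1 < X0 + 1 := by nlinarith
      have u2 : X0 < X1 + 2 := by nlinarith
      omega
    have f4 : Y2 = Y0 ∨ Y2 = Y0 - 1 := by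
      have u1 : Y2 < Y0 + 1 := by nlinarith
      have u2 : Y0 < Y2 + 2 := by nlinarith
      omega
    subst f1 f2
    rcases f3 with f3 | f3 <;> rcases f4 with f4 | f4
    · subst f3 f4
      have g1 : (a1 : ℤ) = a0 - 1 := by linarith
      have g2 : (b1 : ℤ) = b0 := by linarith
      have g3 : (a2 : ℤ) = a0 := by linarith
      have g4 : (b2 : ℤ) = b0 - 1 := by linarith
      clear e1 e2 e3 e4 IH
      fin_cases j0 <;> fin_cases j1 <;> fin_cases j2 <;> simp [be] at z0 z1 z2 <;> omega
    · subst f3 f4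
      have g3 : (a2 : ℤ) = a0 := by linarith
      have g4 : (b2 : ℤ) = b0 - 1 + L := by linarith
      have g1 : (a1 : ℤ) = a0 - 1 := by linarith
      omega
    · subst f3 f4
      have g1 : (a1 : ℤ) = a0 - 1 + L := by linarith
      have g2 : (b1 : ℤ) = b0 := by linarith
      have g4 : (b2 : ℤ) = b0 - 1 := by linarith
      omega
    · exact IH f3 rfl rfl f4

end

section
variable {q : Fin 3 → E2} {l : ℕ → ℕ}

lemma be_sum (l : ℕ) (e : ℕ × ℕ) (i j k : Fin 3) (hij : i ≠ j) (hik : i ≠ k) (hjk : j ≠ k) :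
    be l e i + be l e j + be l e k = l - 1 := by
  fin_cases i <;> fin_cases j <;> fin_cases k <;> simp [be] at hij hik hjk ⊢ <;> ring

lemma fin3_cases : ∀ a i j k : Fin 3, i ≠ j → i ≠ k → j ≠ k → a = i ∨ a = j ∨ a = k := by decide

lemma fin3_others : ∀ i : Fin 3, ∃ j j' : Fin 3, i ≠ j ∧ i ≠ j' ∧ j ≠ j' := by decide

lemma be_zero_cases (l : ℕ) (hl : 5 ≤ l) (e : ℕ × ℕ) (he : e ∈ Sset l) (i j k : Fin 3) (hij : i ≠ j)
    (hik : i ≠ k) (hjk : j ≠ k) : be l e i = 0 ∨ be l e j = 0 ∨ be l e k = 0 := by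
  obtain ⟨a, ha⟩ := be_zero l hl e he
  have := fin3_cases a i j k hij hik hjk
  rcases this with rfl | rfl | rfl <;> simp [ha]

lemma side_card (l : ℕ) (F : Finset (ℕ × ℕ)) (i j : Fin 3) (hij : i ≠ j) (lo hi : ℤ)
    (h : ∀ e ∈ F, be l e i = 0 ∧ lo ≤ be l e j ∧ be l e j ≤ hi) : F.card ≤ (hi + 1 - lo).toNat := by
  rw [← Int.card_Icc]
  apply Finset.card_le_card_of_injOn (fun e => be l e j)
  · intro e he
    have := h e he
    simp [this.2.1, this.2.2]
  · intro e he e' he' hee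
    have h1 := (h e he).1
    have h2 := (h e' he').1
    obtain ⟨a, b⟩ := e
    obtain ⟨a', b'⟩ := e'
    clear h he he'
    fin_cases i <;> fin_cases j <;> simp [be] at hij h1 h2 hee ⊢ <;> omega

lemma card_S (l : ℕ) (hl : 5 ≤ l) (F : Finset (ℕ × ℕ)) (hF : ∀ e ∈ F, e ∈ Sset l) :
    F.card ≤ 3 * l - 3 := by
  classical
  calc F.card ≤ ((Finset.range (3 * l - 3)).image (ringE l)).card := by
        apply Finset.card_le_card
        intro e he
        obtain ⟨t, ht, rfl⟩ := ringE_surj l hl e (hF e he)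
        exact Finset.mem_image.2 ⟨t, Finset.mem_range.2 ht, rfl⟩
    _ ≤ _ := Finset.card_image_le.trans (by simp)

lemma countA (l : ℕ) (hl : 5 ≤ l) (F : Finset (ℕ × ℕ)) (hF : ∀ e ∈ F, e ∈ Sset l) (c : ℕ × ℕ)
    (k : ℕ) (i j j' : Fin 3) (hij : i ≠ j) (hij' : i ≠ j') (hjj : j ≠ j') (hi : be l c i = 0)
    (h : ∀ e ∈ F, ∀ a, be l e a ≤ be l c a + k ∧ be l c a ≤ be l e a + k) :
    F.card ≤ (min ((l : ℤ) - 1) (be l c j + k) + 1 - max 0 (be l c j - k)).toNat + k + k := by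
  classical
  have hsub : F ⊆ (F.filter fun e => be l e i = 0) ∪
      ((F.filter fun e => be l e j = 0 ∧ 1 ≤ be l e i) ∪
        (F.filter fun e => be l e j' = 0 ∧ 1 ≤ be l e i)) := by
    intro e he
    have h1 := be_zero_cases l hl e (hF e he) i j j' hij hij' hjj
    have h2 := be_nonneg l hl e (hF e he) i
    simp only [Finset.mem_union, Finset.mem_filter, he, true_and]
    omega
  have c1 : (F.filter fun e => be l e i = 0).card ≤
      (min ((l : ℤ) - 1) (be l c j + k) + 1 - max 0 (be l c j - k)).toNat := by
    apply side_card l _ i j hij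
    intro e he
    obtain ⟨he, h0⟩ := Finset.mem_filter.1 he
    have h1 := h e he j
    have h2 := be_nonneg l hl e (hF e he) j
    have h3 := be_nonneg l hl e (hF e he) j'
    have h4 := be_sum l e i j j' hij hij' hjj
    exact ⟨h0, by omega, by omega⟩
  have c2 : (F.filter fun e => be l e j = 0 ∧ 1 ≤ be l e i).card ≤ ((k : ℤ) + 1 - 1).toNat := by
    apply side_card l _ j i hij.symm
    intro e he
    obtain ⟨he, h0, h0'⟩ := Finset.mem_filter.1 he
    have h1 := h e he i
    exact ⟨h0, by omega, by omega⟩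
  have c3 : (F.filter fun e => be l e j' = 0 ∧ 1 ≤ be l e i).card ≤ ((k : ℤ) + 1 - 1).toNat := by
    apply side_card l _ j' i hij'.symm
    intro e he
    obtain ⟨he, h0, h0'⟩ := Finset.mem_filter.1 he
    have h1 := h e he i
    exact ⟨h0, by omega, by omega⟩
  have := (Finset.card_le_card hsub).trans (Finset.card_union_le _ _)
  have := this.trans (Nat.add_le_add_left (Finset.card_union_le _ _) _)
  omega

lemma countD (l : ℕ) (hl : 5 ≤ l) (F : Finset (ℕ × ℕ)) (hF : ∀ e ∈ F, e ∈ Sset l) (i : Fin 3)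
    (ρ : ℤ) (hρ : ρ ≤ l - 2) (h : ∀ e ∈ F, (l : ℤ) - 1 - ρ ≤ be l e i) :
    F.card ≤ (ρ + 1).toNat + ρ.toNat := by
  classical
  obtain ⟨j, j', hij, hij', hjj⟩ := fin3_others i
  have hsub : F ⊆ (F.filter fun e => be l e j = 0) ∪
        (F.filter fun e => be l e j' = 0 ∧ 1 ≤ be l e j) := by
    intro e he
    have h1 := be_zero_cases l hl e (hF e he) i j j' hij hij' hjj
    have h2 := be_nonneg l hl e (hF e he) j
    have h3 := h e he
    simp only [Finset.mem_union, Finset.mem_filter, he, true_and]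
    omega
  have c1 : (F.filter fun e => be l e j = 0).card ≤ ((l : ℤ) - 1 + 1 - (l - 1 - ρ)).toNat := by
    apply side_card l _ j i hij.symm
    intro e he
    obtain ⟨he, h0⟩ := Finset.mem_filter.1 he
    have h1 := h e he
    have h3 := be_nonneg l hl e (hF e he) j'
    have h4 := be_sum l e i j j' hij hij' hjj
    exact ⟨h0, by omega, by omega⟩
  have c2 : (F.filter fun e => be l e j' = 0 ∧ 1 ≤ be l e j).card ≤
      ((l : ℤ) - 2 + 1 - (l - 1 - ρ)).toNat := by
    apply side_card l _ j' i hij'.symm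
    intro e he
    obtain ⟨he, h0, h0'⟩ := Finset.mem_filter.1 he
    have h1 := h e he
    have h4 := be_sum l e i j j' hij hij' hjj
    exact ⟨h0, by omega, by omega⟩
  have := (Finset.card_le_card hsub).trans (Finset.card_union_le _ _)
  omega

lemma img_card (hl : ∀ m, 5 ≤ l m) (m : ℕ) (J : Finset (ℕ → ℕ × ℕ)) (hJ : ∀ w ∈ J, w ∈ Wn l (m + 1))
    (X Y : ℤ) (h : ∀ w ∈ J, px l w m = X ∧ py l w m = Y) :
    (J.image fun w => w m).card = J.card := by
  apply Finset.card_image_of_injOn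
  intro w hw w' hw' e
  have h1 := h w hw
  have h2 := h w' hw'
  apply pos_inj' l hl (m + 1) w w' (hJ w hw) (hJ w' hw')
  · simp only [px]; rw [h1.1, h2.1, show w m = w' m from e]
  · simp only [py]; rw [h1.2, h2.2, show w m = w' m from e]

/-- an outside cell close to the corner `j` has its parent touching the corner `j` -/
lemma near_corner (l : ℕ) (hl : 5 ≤ l) (e : ℕ × ℕ) (he : e ∈ Sset l) (X Y ρ : ℤ) (j i : Fin 3)
    (hρ : ρ ≤ l - 1)
    (H : HD (l * X + e.1 - l * ex j + ex i) (l * Y + e.2 - l * ey j + ey i) ρ) :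
    ∃ j', X = ex j - ex j' ∧ Y = ey j - ey j' ∧ (l : ℤ) - 1 - ρ ≤ be l e j' := by
  have b1 := e_lattice l hl e he
  obtain ⟨xi1, xi2, xi3⟩ := ex_bd i
  obtain ⟨Z, hZ⟩ : ∃ Z, Z = X - ex j := ⟨_, rfl⟩
  obtain ⟨W, hW⟩ : ∃ W, W = Y - ey j := ⟨_, rfl⟩
  have eX : X = Z + ex j := by omega
  have eY : Y = W + ey j := by omega
  have hH : HD (l * Z + e.1 + ex i) (l * W + e.2 + ey i) ρ := by
    rw [eX, eY] at H
    convert H using 1 <;> ring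
  unfold HD at hH
  have hL : (5:ℤ) ≤ l := by exact_mod_cast hl
  have z1 : Z < 1 := by nlinarith
  have z2 : -2 < Z := by nlinarith
  have w1 : W < 1 := by nlinarith
  have w2 : -2 < W := by nlinarith
  have s2 : -2 < Z + W := by nlinarith
  have cases3 : (Z = 0 ∧ W = 0) ∨ (Z = -1 ∧ W = 0) ∨ (Z = 0 ∧ W = -1) := by omega
  rcases cases3 with ⟨rfl, rfl⟩ | ⟨rfl, rfl⟩ | ⟨rfl, rfl⟩
  · refine ⟨0, by simp [ex] at *; omega, by simp [ey] at *; omega, ?_⟩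
    rw [be0]; omega
  · refine ⟨1, by simp [ex] at *; omega, by simp [ey] at *; omega, ?_⟩
    rw [be1]; omega
  · refine ⟨2, by simp [ex] at *; omega, by simp [ey] at *; omega, ?_⟩
    rw [be2]; omega

/-- at most one foreign parent per corner -/
lemma one_parent (hl : ∀ m, 5 ≤ l m) (m : ℕ) (w0 w1 w2 : ℕ → ℕ × ℕ)
    (h0 : ∀ k < m, w0 k ∈ Sset (l k)) (h1 : ∀ k < m, w1 k ∈ Sset (l k))
    (h2 : ∀ k < m, w2 k ∈ Sset (l k)) (j a b : Fin 3) (hja : j ≠ a) (hjb : j ≠ b)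
    (e1 : px l w1 m - px l w0 m = ex j - ex a) (e2 : py l w1 m - py l w0 m = ey j - ey a)
    (e3 : px l w2 m - px l w0 m = ex j - ex b) (e4 : py l w2 m - py l w0 m = ey j - ey b) :
    a = b := by
  by_contra hab
  have A := no_three hl m w0 w1 w2 h0 h1 h2
  have B := no_three hl m w0 w2 w1 h0 h2 h1
  have C := no_three hl m w1 w0 w2 h1 h0 h2
  have D := no_three hl m w1 w2 w0 h1 h2 h0
  have E := no_three hl m w2 w0 w1 h2 h0 h1
  have F := no_three hl m w2 w1 w0 h2 h1 h0
  fin_cases j <;> fin_cases a <;> fin_cases b <;> simp [ex, ey] at hja hjb hab e1 e2 e3 e4 <;>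
    first
    | exact A (by omega) (by omega) (by omega) (by omega)
    | exact B (by omega) (by omega) (by omega) (by omega)
    | exact C (by omega) (by omega) (by omega) (by omega)
    | exact D (by omega) (by omega) (by omega) (by omega)
    | exact E (by omega) (by omega) (by omega) (by omega)
    | exact F (by omega) (by omega) (by omega) (by omega)

end

section
variable {q : Fin 3 → E2} {l : ℕ → ℕ}

lemma outside_card (hl : ∀ m, 5 ≤ l m) (m : ℕ) (J : Finset (ℕ → ℕ × ℕ))
    (hJ : ∀ w ∈ J, w ∈ Wn l (m + 1)) (w0 : ℕ → ℕ × ℕ) (hw0 : w0 ∈ Wn l (m + 1)) (j : Fin 3) (ρ : ℤ)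
    (hρ : ρ ≤ l m - 1)
    (h : ∀ w ∈ J, ¬ (px l w m - px l w0 m = 0 ∧ py l w m - py l w0 m = 0) ∧ ∃ i,
      HD (l m * (px l w m - px l w0 m) + (w m).1 - l m * ex j + ex i)
        (l m * (py l w m - py l w0 m) + (w m).2 - l m * ey j + ey i) ρ) :
    J.card ≤ 3 * l m - 3 ∧ (ρ ≤ l m - 2 → J.card ≤ (ρ + 1).toNat + ρ.toNat) := by
  classical
  rcases J.eq_empty_or_nonempty with rfl | ⟨w1, hw1⟩
  · simp
  have key : ∀ w ∈ J, ∃ j', j ≠ j' ∧ px l w m - px l w0 m = ex j - ex j' ∧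
      py l w m - py l w0 m = ey j - ey j' ∧ (l m : ℤ) - 1 - ρ ≤ be (l m) (w m) j' := by
    intro w hw
    obtain ⟨hne, i, hi⟩ := h w hw
    obtain ⟨j', e1, e2, e3⟩ := near_corner (l m) (hl m) (w m) ((hJ w hw).1 m (by omega)) _ _ ρ j i hρ hi
    refine ⟨j', ?_, e1, e2, e3⟩
    rintro rfl
    exact hne ⟨by omega, by omega⟩
  obtain ⟨a, ha, a1, a2, a3⟩ := key w1 hw1
  have key2 : ∀ w ∈ J, px l w m - px l w0 m = ex j - ex a ∧
      py l w m - py l w0 m = ey j - ey a ∧ (l m : ℤ) - 1 - ρ ≤ be (l m) (w m) a := by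
    intro w hw
    obtain ⟨b, hb, b1, b2, b3⟩ := key w hw
    have : a = b := one_parent hl m w0 w1 w (fun k hk => hw0.1 k (by omega))
      (fun k hk => (hJ w1 hw1).1 k (by omega)) (fun k hk => (hJ w hw).1 k (by omega)) j a b ha hb
      a1 a2 b1 b2
    subst this
    exact ⟨b1, b2, b3⟩
  have hS : ∀ e ∈ J.image (fun w => w m), e ∈ Sset (l m) := by
    intro e he
    obtain ⟨w, hw, rfl⟩ := Finset.mem_image.1 he
    exact (hJ w hw).1 m (by omega)
  have hcard := img_card hl m J hJ (px l w0 m + ex j - ex a) (py l w0 m + ey j - ey a) (by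
    intro w hw
    obtain ⟨b1, b2, _⟩ := key2 w hw
    exact ⟨by omega, by omega⟩)
  rw [← hcard]
  refine ⟨card_S _ (hl m) _ hS, fun h2 => countD _ (hl m) _ hS a ρ h2 ?_⟩
  intro e he
  obtain ⟨w, hw, rfl⟩ := Finset.mem_image.1 he
  exact (key2 w hw).2.2

lemma arith_total (l k A D0 D1 D2 : ℕ) (b : ℤ) (hl : 5 ≤ l) (h2 : 2 ≤ k) (hk : k ≤ l) (hb : 0 ≤ b)
    (hb' : b ≤ l - 1)
    (a1 : A ≤ (min ((l : ℤ) - 1) (b + k) + 1 - max 0 (b - k)).toNat + k + k) (a2 : A ≤ 3 * l - 3)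
    (d0 : D0 ≤ 3 * l - 3 ∧ ((k : ℤ) - l ≤ l - 2 → D0 ≤ ((k : ℤ) - l + 1).toNat + ((k : ℤ) - l).toNat))
    (d1 : D1 ≤ 3 * l - 3 ∧
      ((k : ℤ) - l + b ≤ l - 2 → D1 ≤ ((k : ℤ) - l + b + 1).toNat + ((k : ℤ) - l + b).toNat))
    (d2 : D2 ≤ 3 * l - 3 ∧ ((k : ℤ) - l + (l - 1 - b) ≤ l - 2 →
      D2 ≤ ((k : ℤ) - l + (l - 1 - b) + 1).toNat + ((k : ℤ) - l + (l - 1 - b)).toNat)) :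
    A + D0 + D1 + D2 ≤ 6 * k := by
  have e0 := d0.2 (by omega)
  obtain ⟨-, d1'⟩ := id d1
  obtain ⟨-, d2'⟩ := id d2
  have d1 := d1.1
  have d2 := d2.1
  clear d0
  omega

lemma upper (hq : ∀ j k : Fin 3, j ≠ k → dist (q j) (q k) = 1) (hl : ∀ m, 5 ≤ l m)
    {μ : Measure E2} (hμ : IsUnif q l μ) (x : E2) (hx : x ∈ Gasket q l) (m k : ℕ) (h2 : 2 ≤ k)
    (hk : k ≤ l m) (s : ℝ) (hs : s ≤ (k : ℝ) / Ln l (m + 1)) :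
    μ (Bd q l x s) ≤ ENNReal.ofReal (6 * (k : ℝ) / (Mn l (m + 1) : ℝ)) := by
  classical
  obtain ⟨w0, hw0, hxw⟩ := (mem_Gasket q l x).1 hx (m + 1)
  obtain ⟨c, hc⟩ : ∃ c, c = w0 m := ⟨_, rfl⟩
  have hcS : c ∈ Sset (l m) := hc ▸ hw0.1 m (by omega)
  obtain ⟨G, hG⟩ : ∃ G : (ℕ → ℕ × ℕ) → ℤ, G = fun w =>
    Gf (l m) c (px l w m - px l w0 m) (py l w m - py l w0 m) (w m) := ⟨_, rfl⟩
  have hstep : ∀ w ∈ Wn l (m + 1), ∀ w' ∈ Wn l (m + 1), ∀ y, y ∈ TT q l (m + 1) w →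
      y ∈ TT q l (m + 1) w' → G w' ≤ G w + 1 := by
    intro w hw w' hw' y hy hy'
    by_cases hp : px l w (m + 1) = px l w' (m + 1) ∧ py l w (m + 1) = py l w' (m + 1)
    · rw [pos_inj' l hl (m + 1) w w' hw hw' hp.1 hp.2]; omega
    · obtain ⟨a, b, e1, e2, -, -⟩ := overlap q hq l hl (m + 1) w w' y hy hy' hp
      simp only [px, py] at e1 e2
      rw [hG]
      apply Gf_step (l m) (hl m) c (w m) (w' m) hcS (hw.1 m (by omega)) (hw'.1 m (by omega)) _ _ _ _ a b
      · linear_combination e1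
      · linear_combination e2
  have hG0 : G w0 = 0 := by
    rw [hG]; simp [Gf, hd, hc]
  obtain ⟨J, hJdef⟩ : ∃ J, J = (WF l (m + 1)).filter fun w => G w ≤ k := ⟨_, rfl⟩
  have hJ : ∀ w ∈ J, w ∈ Wn l (m + 1) ∧ G w ≤ k := by
    intro w hw
    rw [hJdef, Finset.mem_filter, mem_WF l hl] at hw
    exact hw
  have hsub : Bd q l x s ⊆ ⋃ w ∈ J, Cell q l (m + 1) w := by
    intro y hy
    obtain ⟨w', hw', hy', hg⟩ := ball_cell hq hl (m + 1) G hstep x hx w0 hw0 hxw hG0 k s hs y hy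
    simp only [mem_iUnion]
    refine ⟨w', ?_, hy'⟩
    rw [hJdef, Finset.mem_filter, mem_WF l hl]
    exact ⟨hw', hg⟩
  have hcard : J.card ≤ 6 * k := by
    obtain ⟨i0, hi0⟩ := be_zero (l m) (hl m) c hcS
    obtain ⟨j1, j2, h01, h02, h12⟩ := fin3_others i0
    have hbs := be_sum (l m) c i0 j1 j2 h01 h02 h12
    have hb1 := be_nonneg (l m) (hl m) c hcS j1
    have hb2 := be_nonneg (l m) (hl m) c hcS j2
    obtain ⟨JA, hJA⟩ : ∃ JA, JA = J.filter fun w => px l w m - px l w0 m = 0 ∧ py l w m - py l w0 m = 0 :=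
      ⟨_, rfl⟩
    obtain ⟨D, hD⟩ : ∃ D : Fin 3 → Finset (ℕ → ℕ × ℕ), D = fun j => J.filter fun w =>
      ¬ (px l w m - px l w0 m = 0 ∧ py l w m - py l w0 m = 0) ∧ ∃ i,
      HD (l m * (px l w m - px l w0 m) + (w m).1 - l m * ex j + ex i)
        (l m * (py l w m - py l w0 m) + (w m).2 - l m * ey j + ey i) (k - l m + be (l m) c j) := ⟨_, rfl⟩
    have hcov : J ⊆ ((JA ∪ D i0) ∪ D j1) ∪ D j2 := by
      intro w hw
      have hg := (hJ w hw).2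
      by_cases hp : px l w m - px l w0 m = 0 ∧ py l w m - py l w0 m = 0
      · simp only [Finset.mem_union]
        left; left; left
        rw [hJA]
        exact Finset.mem_filter.2 ⟨hw, hp⟩
      · rw [hG] at hg
        obtain ⟨j, hj⟩ := (Gf_out (l m) c _ _ (w m) k hp).1 hg
        have hwD : w ∈ D j := by
          rw [hD]; exact Finset.mem_filter.2 ⟨hw, hp, hj⟩
        simp only [Finset.mem_union]
        rcases fin3_cases j i0 j1 j2 h01 h02 h12 with rfl | rfl | rfl <;> tauto
    have hA : JA.card ≤ (min ((l m : ℤ) - 1) (be (l m) c j1 + k) + 1 - max 0 (be (l m) c j1 - k)).toNat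
        + k + k ∧ JA.card ≤ 3 * l m - 3 := by
      have hJA' : ∀ w ∈ JA, w ∈ J ∧ px l w m - px l w0 m = 0 ∧ py l w m - py l w0 m = 0 := by
        intro w hw
        rw [hJA] at hw
        exact Finset.mem_filter.1 hw
      have hS : ∀ e ∈ JA.image (fun w => w m), e ∈ Sset (l m) := by
        intro e he
        obtain ⟨w, hw, rfl⟩ := Finset.mem_image.1 he
        exact (hJ w (hJA' w hw).1).1.1 m (by omega)
      have hcd := img_card hl m JA (fun w hw => (hJ w (hJA' w hw).1).1) (px l w0 m) (py l w0 m) (by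
        intro w hw
        obtain ⟨_, b1, b2⟩ := hJA' w hw
        exact ⟨by omega, by omega⟩)
      rw [← hcd]
      refine ⟨countA (l m) (hl m) _ hS c k i0 j1 j2 h01 h02 h12 hi0 ?_, card_S _ (hl m) _ hS⟩
      intro e he a
      obtain ⟨w, hw, rfl⟩ := Finset.mem_image.1 he
      obtain ⟨hwJ, p1, p2⟩ := hJA' w hw
      have hg := (hJ w hwJ).2
      rw [hG] at hg
      simp only [p1, p2] at hg
      rw [Gf_in] at hg
      unfold HD at hg
      fin_cases a
      · simp only [Fin.zero_eta, be0]; omega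
      · simp only [Fin.mk_one, be1]; omega
      · simp only [Fin.reduceFinMk, be2]; omega
    have hDc : ∀ j, be (l m) c j ≤ l m - 1 → (D j).card ≤ 3 * l m - 3 ∧
        ((k : ℤ) - l m + be (l m) c j ≤ l m - 2 → (D j).card ≤
          ((k : ℤ) - l m + be (l m) c j + 1).toNat + ((k : ℤ) - l m + be (l m) c j).toNat) := by
      intro j hj
      have hD' : ∀ w ∈ D j, w ∈ J ∧ (¬ (px l w m - px l w0 m = 0 ∧ py l w m - py l w0 m = 0) ∧ ∃ i,
          HD (l m * (px l w m - px l w0 m) + (w m).1 - l m * ex j + ex i)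
          (l m * (py l w m - py l w0 m) + (w m).2 - l m * ey j + ey i) (k - l m + be (l m) c j)) := by
        intro w hw
        rw [hD] at hw
        exact Finset.mem_filter.1 hw
      exact outside_card hl m (D j) (fun w hw => (hJ w (hD' w hw).1).1) w0 hw0 j _ (by omega)
        (fun w hw => (hD' w hw).2)
    have c0 := hDc i0 (by omega)
    have c1 := hDc j1 (by omega)
    have c2 := hDc j2 (by omega)
    rw [hi0, add_zero] at c0
    rw [show be (l m) c j2 = l m - 1 - be (l m) c j1 by omega] at c2
    have tot := arith_total (l m) k _ _ _ _ (be (l m) c j1) (hl m) h2 hk hb1 (by omega) hA.1 hA.2 c0 c1 c2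
    have u1 := Finset.card_le_card hcov
    have u2 := Finset.card_union_le (JA ∪ D i0 ∪ D j1) (D j2)
    have u3 := Finset.card_union_le (JA ∪ D i0) (D j1)
    have u4 := Finset.card_union_le JA (D i0)
    omega
  have hM := Mn_pos hl (m + 1)
  calc μ (Bd q l x s) ≤ _ := measure_mono hsub
    _ ≤ _ := cells_le hl hμ (m + 1) J fun w hw => (hJ w hw).1
    _ ≤ ((6 * k : ℕ) : ℝ≥0∞) * (Mn l (m + 1) : ℝ≥0∞)⁻¹ := by gcongr
    _ = _ := by
      rw [ENNReal.ofReal_div_of_pos (by exact_mod_cast hM), ENNReal.ofReal_natCast, div_eq_mul_inv,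
        show 6 * (k : ℝ) = ((6 * k : ℕ) : ℝ) by push_cast; ring, ENNReal.ofReal_natCast]

end

/-- Two-sided estimates of `Ψ(s)` and of `m(B_d(x,s))`. -/
theorem stmt11 (q : Fin 3 → E2) (hq : ∀ j k : Fin 3, j ≠ k → dist (q j) (q k) = 1)
    (l : ℕ → ℕ) (hl : ∀ m, 5 ≤ l m)
    (μ : Measure E2) (hμ : IsUnif q l μ) (Psi : ℝ → ℝ) (hPsi : IsPsi l Psi)
    (x : E2) (hx : x ∈ Gasket q l) (s : ℝ) (hs : 0 < s)
    (n : ℕ) (hn : 1 ≤ n) (k : ℕ) (hk2 : 2 ≤ k) (hkl : k ≤ l (n - 1)) :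
    (((k : ℝ) - 1) / (Ln l n : ℝ) ≤ s → s ≤ (k : ℝ) / (Ln l n : ℝ) →
      ((1 / 18) * (k : ℝ) ^ 2 / Tn l n ≤ Psi s ∧
       Psi s ≤ (9 / 2) * (k : ℝ) ^ 2 / Tn l n) ∧
      (ENNReal.ofReal ((7 / 36) * (k : ℝ) / (Mn l n : ℝ)) ≤ μ (Bd q l x s) ∧
       μ (Bd q l x s) ≤ ENNReal.ofReal (6 * (k : ℝ) / (Mn l n : ℝ)))) ∧
    ((1 : ℝ) ≤ s → s ≤ 3 →
      ((1 : ℝ) ≤ Psi s ∧ Psi s ≤ 14) ∧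
      (ENNReal.ofReal (7 / 12) ≤ μ (Bd q l x s) ∧ μ (Bd q l x s) ≤ 1)) := by
  obtain ⟨m, rfl⟩ : ∃ m, n = m + 1 := ⟨n - 1, by omega⟩
  rw [Nat.add_sub_cancel] at hkl
  refine ⟨fun h1 h2 => ⟨psi_small hl Psi hPsi m k hk2 hkl s h1 h2,
    low_main hq hl hμ x hx m k hk2 hkl s h1, upper hq hl hμ x hx m k hk2 hkl s h2⟩,
    fun h1 h3 => ⟨psi_big hl Psi hPsi s h1 h3, ?_, ?_⟩⟩
  · have h := low_full hq hl hμ x hx 0 s (by simpa [Ln] using h1)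
    simpa [Mn] using h
  · exact (measure_mono fun y hy => hy.1).trans (Gasket_meas hμ).le

end
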